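/- arXiv:2401.08731 — 5 statements merged into one kernel-verified Lean document; each statement's English description precedes it below -/
import Mathlib

section
/- For every f ∈ L¹(ℝ), every t > 0 and every ξ ∈ ℝ, the function P_t f is integrable and its Fourier transform satisfies 𝓕(P_t f)(ξ) = exp(−t·√(2π|ξ|)·e^{−i·sgn(ξ)·π/4}) · 𝓕f(ξ); equivalently, the Fourier multiplier symbol of P_t is e^{−t√(−2πiξ)} with the principal branch of the square root. -/
open MeasureTheory

/-- The subordinated Poisson semigroup of the translation group on `ℝ`:
`P_t f (x) = (1/√π) ∫_0^∞ (e^{−u}/√u) f(x + t²/(4u)) du`. -/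
noncomputable def poissonP (f : ℝ → ℂ) (t : ℝ) (x : ℝ) : ℂ :=
  ((Real.sqrt Real.pi)⁻¹ : ℂ) *
    ∫ u in Set.Ioi (0 : ℝ), ((Real.exp (-u) / Real.sqrt u : ℝ) : ℂ) * f (x + t ^ 2 / (4 * u))
/-- The principal branch value `√(−2πiξ) = √(2π|ξ|)·e^{−i·sgn(ξ)·π/4}`. -/
noncomputable def sqrtSymbol (ξ : ℝ) : ℂ :=
  (Real.sqrt (2 * Real.pi * |ξ|) : ℂ) *
    Complex.exp (-(Real.sign ξ : ℂ) * Complex.I * (Real.pi : ℂ) / 4)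

/-- `φ̂(ξ) = −√(−2πiξ)·e^{−√(−2πiξ)}`. -/
noncomputable def phiHat (ξ : ℝ) : ℂ := -sqrtSymbol ξ * Complex.exp (-sqrtSymbol ξ)

/-- `φ`, the inverse Fourier transform of `φ̂`. -/
noncomputable def phi (x : ℝ) : ℂ :=
  ∫ ξ : ℝ, Complex.exp (2 * (Real.pi : ℂ) * Complex.I * (x : ℂ) * (ξ : ℂ)) * phiHat ξ

/-- The dilation `φ_t(x) = t⁻¹ φ(x/t)`. -/
noncomputable def phiT (t : ℝ) (x : ℝ) : ℂ := ((t : ℂ))⁻¹ * phi (x / t)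

/-- The Fourier transform `𝓕f(ξ) = ∫_ℝ f(x) e^{−2πixξ} dx`. -/
noncomputable def FT (f : ℝ → ℂ) (ξ : ℝ) : ℂ :=
  ∫ x : ℝ, Complex.exp (-(2 * (Real.pi : ℂ) * Complex.I * (x : ℂ) * (ξ : ℂ))) * f x

open Set Filter Topology

lemma hasDerivAt_sub_div (a : ℝ) {v : ℝ} (hv : 0 < v) :
    HasDerivAt (fun v : ℝ => v - a / v) (1 + a / v ^ 2) v := by
  have h : HasDerivAt (fun v : ℝ => v - a * v⁻¹) (1 - a * -(v ^ 2)⁻¹) v :=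
    (hasDerivAt_id v).sub ((hasDerivAt_inv hv.ne').const_mul a)
  simpa [div_eq_mul_inv] using h

lemma image_sub_div_Ioi {a : ℝ} (ha : 0 < a) :
    (fun v : ℝ => v - a / v) '' Ioi 0 = univ := by
  refine eq_univ_of_forall fun y => ?_
  have hs : |y| < √(y ^ 2 + 4 * a) := by
    rw [← Real.sqrt_sq_eq_abs]
    exact Real.sqrt_lt_sqrt (sq_nonneg y) (by linarith)
  have hpos : 0 < (y + √(y ^ 2 + 4 * a)) / 2 := by
    linarith [neg_abs_le y]
  refine ⟨(y + √(y ^ 2 + 4 * a)) / 2, hpos, ?_⟩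
  have hsq : √(y ^ 2 + 4 * a) ^ 2 = y ^ 2 + 4 * a := Real.sq_sqrt (by positivity)
  have hne : y + √(y ^ 2 + 4 * a) ≠ 0 := by linarith
  field_simp
  linear_combination hsq

lemma injOn_sub_div_Ioi {a : ℝ} (ha : 0 < a) : InjOn (fun v : ℝ => v - a / v) (Ioi 0) := by
  refine StrictMonoOn.injOn fun v hv w _ hvw => ?_
  have : a / w < a / v := div_lt_div_of_pos_left ha hv hvw
  linarith

/-- The Cauchy–Schlömilch substitution for the Gaussian. -/
lemma integral_exp_neg_sub_div_sq {a : ℝ} (ha : 0 < a) :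
    ∫ v in Ioi (0 : ℝ), Real.exp (-(v - a / v) ^ 2) = √Real.pi / 2 := by
  have hd : ∀ v ∈ Ioi (0 : ℝ),
      HasDerivWithinAt (fun v : ℝ => v - a / v) (1 + a / v ^ 2) (Ioi 0) v :=
    fun v hv => (hasDerivAt_sub_div a hv).hasDerivWithinAt
  have habs : ∀ v ∈ Ioi (0 : ℝ), |1 + a / v ^ 2| • Real.exp (-(v - a / v) ^ 2) =
      Real.exp (-(v - a / v) ^ 2) + a / v ^ 2 * Real.exp (-(v - a / v) ^ 2) := fun v hv => by
    rw [abs_of_nonneg (by positivity), smul_eq_mul]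
    ring
  have hgi : Integrable (fun y : ℝ => Real.exp (-y ^ 2)) := by
    simpa using integrable_exp_neg_mul_sq one_pos
  have hint := (integrableOn_image_iff_integrableOn_abs_deriv_smul measurableSet_Ioi hd
    (injOn_sub_div_Ioi ha) (fun y => Real.exp (-y ^ 2))).1 hgi.integrableOn
  have htotal := integral_image_eq_integral_abs_deriv_smul measurableSet_Ioi hd
    (injOn_sub_div_Ioi ha) (fun y => Real.exp (-y ^ 2))
  rw [integrableOn_congr_fun habs measurableSet_Ioi] at hint
  rw [setIntegral_congr_fun measurableSet_Ioi habs, image_sub_div_Ioi ha, setIntegral_univ] at htotal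
  have hgauss : ∫ y : ℝ, Real.exp (-y ^ 2) = √Real.pi := by
    simpa using integral_gaussian 1
  have hint₁ : IntegrableOn (fun v : ℝ => Real.exp (-(v - a / v) ^ 2)) (Ioi 0) := by
    refine hint.mono' (by fun_prop) ((ae_restrict_iff' measurableSet_Ioi).2 (.of_forall ?_))
    intro v _
    rw [Real.norm_of_nonneg (Real.exp_pos _).le]
    exact le_add_of_nonneg_right (by positivity)
  have hint₂ : IntegrableOn (fun v : ℝ => a / v ^ 2 * Real.exp (-(v - a / v) ^ 2)) (Ioi 0) :=
    (hint.sub hint₁).congr (.of_forall fun v => by simp)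
  rw [integral_add hint₁ hint₂, hgauss] at htotal
  have himage : (fun v : ℝ => a / v) '' Ioi 0 = Ioi 0 := by
    ext y
    refine ⟨?_, fun hy => ⟨a / y, div_pos ha hy, by have := (mem_Ioi.1 hy).ne'; field_simp⟩⟩
    rintro ⟨v, hv, rfl⟩
    exact div_pos ha hv
  have hinv := integral_image_eq_integral_abs_deriv_smul (s := Ioi 0) (f := fun v : ℝ => a / v)
    (f' := fun v => -(a / v ^ 2)) measurableSet_Ioi
    (fun v hv => by
      simpa [div_eq_mul_inv] using
        ((hasDerivAt_inv (mem_Ioi.1 hv).ne').const_mul a).hasDerivWithinAt (s := Ioi 0))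
    (fun v hv w hw h => by
      have := (mem_Ioi.1 hv).ne'
      have := (mem_Ioi.1 hw).ne'
      simp only at h
      field_simp at h
      exact h.symm)
    (fun y => Real.exp (-(y - a / y) ^ 2))
  rw [himage] at hinv
  have hsymm : ∀ v ∈ Ioi (0 : ℝ), |-(a / v ^ 2)| • Real.exp (-(a / v - a / (a / v)) ^ 2) =
      a / v ^ 2 * Real.exp (-(v - a / v) ^ 2) := fun v hv => by
    rw [abs_neg, abs_of_nonneg (by positivity), smul_eq_mul, div_div_cancel₀ ha.ne']
    ring_nf
  rw [setIntegral_congr_fun measurableSet_Ioi hsymm] at hinv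
  linarith

lemma integral_exp_neg_div_sqrt_mul_exp_neg_sq_div {a : ℝ} (ha : 0 < a) :
    ∫ u in Ioi (0 : ℝ), Real.exp (-u) / √u * Real.exp (-(a ^ 2 / u)) =
      √Real.pi * Real.exp (-2 * a) := by
  have himage : (fun v : ℝ => v ^ 2) '' Ioi 0 = Ioi 0 := by
    ext y
    refine ⟨?_, fun hy => ⟨√y, Real.sqrt_pos.2 hy, Real.sq_sqrt (mem_Ioi.1 hy).le⟩⟩
    rintro ⟨v, hv, rfl⟩
    exact pow_pos (mem_Ioi.1 hv) 2
  have h := integral_image_eq_integral_abs_deriv_smul (s := Ioi 0) (f := fun v : ℝ => v ^ 2)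
    (f' := fun v => 2 * v) measurableSet_Ioi
    (fun v _ => by simpa using (hasDerivAt_pow 2 v).hasDerivWithinAt)
    (fun v hv w hw h => (sq_eq_sq₀ (mem_Ioi.1 hv).le (mem_Ioi.1 hw).le).1 h)
    (fun u => Real.exp (-u) / √u * Real.exp (-(a ^ 2 / u)))
  rw [himage] at h
  have hcongr : ∀ v ∈ Ioi (0 : ℝ),
      |2 * v| • (Real.exp (-v ^ 2) / √(v ^ 2) * Real.exp (-(a ^ 2 / v ^ 2))) =
        2 * Real.exp (-2 * a) * Real.exp (-(v - a / v) ^ 2) := fun v hv => by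
    have hv : 0 < v := hv
    have hexp : Real.exp (-2 * a) * Real.exp (-(v - a / v) ^ 2) =
        Real.exp (-v ^ 2) * Real.exp (-(a ^ 2 / v ^ 2)) := by
      rw [← Real.exp_add, ← Real.exp_add]
      congr 1
      field_simp
      ring
    rw [abs_of_pos (by positivity), Real.sqrt_sq hv.le, mul_assoc, hexp, smul_eq_mul]
    field_simp
  rw [h, setIntegral_congr_fun measurableSet_Ioi hcongr, integral_const_mul,
    integral_exp_neg_sub_div_sq ha]
  ring

lemma integrableOn_exp_neg_div_sqrt :
    IntegrableOn (fun u : ℝ => Real.exp (-u) / √u) (Ioi 0) := by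
  refine (Real.GammaIntegral_convergent (s := 1 / 2) (by norm_num)).congr_fun (fun u hu => ?_)
    measurableSet_Ioi
  have hu : 0 < u := hu
  simp only
  rw [Real.sqrt_eq_rpow, div_eq_mul_inv (Real.exp _), ← Real.rpow_neg hu.le]
  norm_num only

lemma norm_exp_neg_div_sqrt_mul_cexp {u : ℝ} (z : ℂ) :
    ‖((Real.exp (-u) / √u : ℝ) : ℂ) * Complex.exp (-z / u)‖ =
      Real.exp (-u) / √u * Real.exp (-z.re / u) := by
  rw [norm_mul, Complex.norm_real, Real.norm_of_nonneg (by positivity), Complex.norm_exp,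
    Complex.div_ofReal_re, Complex.neg_re]

lemma differentiableOn_integral_exp_neg_div_sqrt_mul_cexp :
    DifferentiableOn ℂ (fun z : ℂ => ∫ u in Ioi (0 : ℝ),
      ((Real.exp (-u) / √u : ℝ) : ℂ) * Complex.exp (-z / u)) {z | 0 < z.re} := by
  intro z hz
  have hz : 0 < z.re := hz
  have hle : ∀ w : ℂ, 0 ≤ w.re → ∀ᵐ u : ℝ ∂volume.restrict (Ioi 0),
      ‖((Real.exp (-u) / √u : ℝ) : ℂ) * Complex.exp (-w / u)‖ ≤ Real.exp (-u) / √u := by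
    intro w hw
    refine (ae_restrict_iff' measurableSet_Ioi).2 (.of_forall fun u hu => ?_)
    have hu : 0 < u := hu
    rw [norm_exp_neg_div_sqrt_mul_cexp]
    refine mul_le_of_le_one_right (by positivity) (Real.exp_le_one_iff.2 ?_)
    rw [neg_div]
    exact neg_nonpos.2 (by positivity)
  have h := hasDerivAt_integral_of_dominated_loc_of_deriv_le (μ := volume.restrict (Ioi (0 : ℝ)))
    (s := {w : ℂ | z.re / 2 < w.re}) (x₀ := z)
    (F := fun w u => ((Real.exp (-u) / √u : ℝ) : ℂ) * Complex.exp (-w / u))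
    (F' := fun w u => ((Real.exp (-u) / √u : ℝ) : ℂ) * (Complex.exp (-w / u) * (-1 / u)))
    (bound := fun u => 2 / z.re * (Real.exp (-u) / √u))
    ((isOpen_lt continuous_const Complex.continuous_re).mem_nhds (half_lt_self hz))
    (.of_forall fun w => by fun_prop)
    (integrableOn_exp_neg_div_sqrt.mono' (by fun_prop) (hle z hz.le))
    (by fun_prop)
    ((ae_restrict_iff' measurableSet_Ioi).2 (.of_forall fun u hu w hw => ?_))
    (integrableOn_exp_neg_div_sqrt.const_mul _)
    ((ae_restrict_iff' measurableSet_Ioi).2 (.of_forall fun u hu w hw => ?_))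
  · exact h.2.differentiableAt.differentiableWithinAt
  · have hu : 0 < u := hu
    have hw : z.re / 2 < w.re := hw
    rw [← mul_assoc, norm_mul, norm_exp_neg_div_sqrt_mul_cexp, mul_comm (2 / z.re), mul_assoc]
    refine mul_le_mul_of_nonneg_left ?_ (by positivity)
    have hnorm : ‖(-1 / u : ℂ)‖ = 1 / u := by
      rw [norm_div, norm_neg, norm_one, Complex.norm_real, Real.norm_of_nonneg hu.le]
    have hwu : w.re / u ≤ Real.exp (w.re / u) := by linarith [Real.add_one_le_exp (w.re / u)]
    rw [hnorm, neg_div, Real.exp_neg, ← div_eq_inv_mul, div_le_iff₀ (Real.exp_pos _)]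
    calc 1 / u = 2 / z.re * (z.re / 2 / u) := by field_simp
      _ ≤ 2 / z.re * (w.re / u) := by gcongr
      _ ≤ 2 / z.re * Real.exp (w.re / u) := by gcongr
  · exact (((hasDerivAt_id w).neg.div_const (u : ℂ)).cexp).const_mul _

lemma integral_exp_neg_div_sqrt_mul_cexp_of_pos {z : ℂ} (hz : 0 < z.re) :
    ∫ u in Ioi (0 : ℝ), ((Real.exp (-u) / √u : ℝ) : ℂ) * Complex.exp (-z / u) =
      (√Real.pi : ℂ) * Complex.exp (-2 * z ^ (2⁻¹ : ℂ)) := by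
  have hopen : IsOpen {z : ℂ | 0 < z.re} := isOpen_lt continuous_const Complex.continuous_re
  refine AnalyticOnNhd.eqOn_of_preconnected_of_frequently_eq (z₀ := 1)
    (differentiableOn_integral_exp_neg_div_sqrt_mul_cexp.analyticOnNhd hopen)
    (g := fun z => (√Real.pi : ℂ) * Complex.exp (-2 * z ^ (2⁻¹ : ℂ)))
    (DifferentiableOn.analyticOnNhd (fun w hw => ?_) hopen)
    (convex_halfSpace_re_gt 0).isPreconnected (by simp) ?_ hz
  · have hw : w ∈ Complex.slitPlane := Or.inl hw
    exact ((((differentiableAt_id.cpow_const hw).const_mul _).cexp).const_mul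
      _).differentiableWithinAt
  · have htend : Tendsto (fun a : ℝ => ((a : ℂ)) ^ 2) (𝓝[>] 1) (𝓝[≠] 1) := by
      refine tendsto_nhdsWithin_iff.2 ⟨?_, ?_⟩
      · have hc : Continuous fun a : ℝ => (a : ℂ) ^ 2 := by fun_prop
        exact (by simpa using hc.tendsto 1 : Tendsto _ (𝓝 (1 : ℝ)) (𝓝 (1 : ℂ))).mono_left
          nhdsWithin_le_nhds
      · filter_upwards [self_mem_nhdsWithin] with a ha
        have ha : 1 < a := ha
        have : a ^ 2 ≠ 1 := by nlinarith
        rw [mem_compl_singleton_iff]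
        exact_mod_cast this
    refine htend.frequently (Eventually.frequently ?_)
    filter_upwards [self_mem_nhdsWithin] with a ha
    have ha : 0 < a := zero_lt_one.trans ha
    rw [Complex.sq_cpow_two_inv (by simpa using ha)]
    have h := congrArg (Complex.ofReal) (integral_exp_neg_div_sqrt_mul_exp_neg_sq_div ha)
    rw [← integral_complex_ofReal] at h
    push_cast at h ⊢
    simpa only [neg_div] using h

/-- The subordination formula on the closed sector `|arg a| ≤ π / 4`. -/
lemma integral_exp_neg_div_sqrt_mul_cexp_sq {a : ℂ} (ha : 0 ≤ a.re) (ha2 : 0 ≤ (a ^ 2).re) :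
    ∫ u in Ioi (0 : ℝ), ((Real.exp (-u) / √u : ℝ) : ℂ) * Complex.exp (-a ^ 2 / u) =
      (√Real.pi : ℂ) * Complex.exp (-2 * a) := by
  have hre : ∀ ε : ℝ, 0 < ε → 0 < (a + ε).re ∧ 0 < ((a + ε) ^ 2).re := fun ε hε => by
    simp only [pow_two, Complex.mul_re, Complex.add_re, Complex.add_im, Complex.ofReal_re,
      Complex.ofReal_im] at ha2 ⊢
    exact ⟨by linarith, by nlinarith [mul_nonneg ha hε.le, mul_pos hε hε]⟩
  have hleft : Tendsto (fun ε : ℝ => ∫ u in Ioi (0 : ℝ),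
      ((Real.exp (-u) / √u : ℝ) : ℂ) * Complex.exp (-(a + ε) ^ 2 / u)) (𝓝[>] 0)
      (𝓝 (∫ u in Ioi (0 : ℝ), ((Real.exp (-u) / √u : ℝ) : ℂ) * Complex.exp (-a ^ 2 / u))) := by
    refine tendsto_integral_filter_of_dominated_convergence (fun u => Real.exp (-u) / √u)
      (.of_forall fun ε => by fun_prop) ?_ integrableOn_exp_neg_div_sqrt
      (.of_forall fun u => ?_)
    · filter_upwards [self_mem_nhdsWithin] with ε hε
      refine (ae_restrict_iff' measurableSet_Ioi).2 (.of_forall fun u hu => ?_)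
      have hu : 0 < u := hu
      rw [norm_exp_neg_div_sqrt_mul_cexp]
      refine mul_le_of_le_one_right (by positivity) (Real.exp_le_one_iff.2 ?_)
      rw [neg_div]
      exact neg_nonpos.2 (div_nonneg (hre ε hε).2.le hu.le)
    · have hc : Continuous fun ε : ℝ =>
          ((Real.exp (-u) / √u : ℝ) : ℂ) * Complex.exp (-(a + ε) ^ 2 / u) := by fun_prop
      exact (by simpa using hc.tendsto 0 : Tendsto _ (𝓝 (0 : ℝ)) _).mono_left nhdsWithin_le_nhds
  have hright : Tendsto (fun ε : ℝ => (√Real.pi : ℂ) * Complex.exp (-2 * (a + ε))) (𝓝[>] 0)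
      (𝓝 ((√Real.pi : ℂ) * Complex.exp (-2 * a))) := by
    have hc : Continuous fun ε : ℝ => (√Real.pi : ℂ) * Complex.exp (-2 * (a + ε)) := by fun_prop
    exact (by simpa using hc.tendsto 0 : Tendsto _ (𝓝 (0 : ℝ)) _).mono_left nhdsWithin_le_nhds
  refine tendsto_nhds_unique (hleft.congr' ?_) hright
  filter_upwards [self_mem_nhdsWithin] with ε hε
  rw [integral_exp_neg_div_sqrt_mul_cexp_of_pos (hre ε hε).2,
    Complex.sq_cpow_two_inv (hre ε hε).1]

lemma sqrtSymbol_re_nonneg (ξ : ℝ) : 0 ≤ (sqrtSymbol ξ).re := by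
  rw [sqrtSymbol, Complex.re_ofReal_mul,
    show (-(Real.sign ξ : ℂ) * Complex.I * (Real.pi : ℂ) / 4) =
      ((-Real.sign ξ * Real.pi / 4 : ℝ) : ℂ) * Complex.I by push_cast; ring,
    Complex.exp_ofReal_mul_I_re]
  refine mul_nonneg (Real.sqrt_nonneg _) (Real.cos_nonneg_of_neg_pi_div_two_le_of_le ?_ ?_) <;>
    rcases Real.sign_apply_eq ξ with h | h | h <;> rw [h] <;> linarith [Real.pi_pos]

lemma sqrtSymbol_sq (ξ : ℝ) : sqrtSymbol ξ ^ 2 = -(2 * Real.pi * Complex.I * ξ) := by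
  have hsq : (√(2 * Real.pi * |ξ|) : ℂ) ^ 2 = 2 * Real.pi * (|ξ| : ℝ) := by
    exact_mod_cast Real.sq_sqrt (by positivity : 0 ≤ 2 * Real.pi * |ξ|)
  rw [sqrtSymbol, mul_pow, hsq, ← Complex.exp_nat_mul]
  rcases lt_trichotomy ξ 0 with h | rfl | h
  · rw [Real.sign_of_neg h, abs_of_neg h,
      show (((2 : ℕ) : ℂ) * (-((-1 : ℝ) : ℂ) * Complex.I * (Real.pi : ℂ) / 4)) =
        Real.pi / 2 * Complex.I by push_cast; ring, Complex.exp_pi_div_two_mul_I]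
    push_cast
    ring
  · simp
  · rw [Real.sign_of_pos h, abs_of_pos h,
      show (((2 : ℕ) : ℂ) * (-((1 : ℝ) : ℂ) * Complex.I * (Real.pi : ℂ) / 4)) =
        -Real.pi / 2 * Complex.I by push_cast; ring, Complex.exp_neg_pi_div_two_mul_I]
    ring

lemma integrable_translation_kernel {f : ℝ → ℂ} (hf : Integrable f) (t : ℝ) :
    Integrable (fun p : ℝ × ℝ => ((Real.exp (-p.1) / √p.1 : ℝ) : ℂ) *
      f (p.2 + t ^ 2 / (4 * p.1))) ((volume.restrict (Ioi 0)).prod volume) := by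
  have hshear : MeasurePreserving (fun p : ℝ × ℝ => (p.1, p.2 + t ^ 2 / (4 * p.1)))
      ((volume.restrict (Ioi 0)).prod volume) ((volume.restrict (Ioi 0)).prod volume) :=
    (MeasurePreserving.id _).skew_product (g := fun u x => x + t ^ 2 / (4 * u))
      (by unfold Function.uncurry; fun_prop)
      (.of_forall fun u => map_add_right_eq_self volume (t ^ 2 / (4 * u)))
  exact hshear.integrable_comp_of_integrable (integrableOn_exp_neg_div_sqrt.ofReal.mul_prod hf)

lemma FT_comp_add_right (f : ℝ → ℂ) (s ξ : ℝ) :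
    FT (fun x => f (x + s)) ξ = Complex.exp (2 * Real.pi * Complex.I * s * ξ) * FT f ξ := by
  rw [FT, FT, ← integral_const_mul, ← integral_add_right_eq_self (fun x => _ * (_ * f x)) s]
  refine integral_congr_ae (.of_forall fun x => ?_)
  simp only
  rw [← mul_assoc, ← Complex.exp_add]
  congr 2
  push_cast
  ring

/-- For every `f ∈ L¹(ℝ)`, `t > 0` and `ξ ∈ ℝ`, `P_t f` is integrable and
`𝓕(P_t f)(ξ) = exp(−t·√(2π|ξ|)·e^{−i·sgn(ξ)·π/4}) · 𝓕f(ξ)`. -/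
theorem fourier_transform_subordinated_poisson
    (f : ℝ → ℂ) (hf : Integrable f) (t : ℝ) (ht : 0 < t) (ξ : ℝ) :
    Integrable (fun x => poissonP f t x) ∧
      FT (fun x => poissonP f t x) ξ =
        Complex.exp (-(t : ℂ) * sqrtSymbol ξ) * FT f ξ := by
  have hker := integrable_translation_kernel hf t
  have hint : Integrable (fun x => poissonP f t x) := hker.integral_prod_right.const_mul _
  refine ⟨hint, ?_⟩
  have hmod : Integrable (Function.uncurry fun u x : ℝ =>
      Complex.exp (-(2 * (Real.pi : ℂ) * Complex.I * (x : ℂ) * (ξ : ℂ))) *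
        (((Real.exp (-u) / √u : ℝ) : ℂ) * f (x + t ^ 2 / (4 * u))))
      ((volume.restrict (Ioi 0)).prod volume) := by
    refine hker.bdd_mul (c := 1) (by fun_prop) (.of_forall fun p => ?_)
    rw [show -(2 * (Real.pi : ℂ) * Complex.I * (p.2 : ℂ) * (ξ : ℂ)) =
      ((-(2 * Real.pi * p.2 * ξ) : ℝ) : ℂ) * Complex.I by push_cast; ring,
      Complex.norm_exp_ofReal_mul_I]
  have hfub := integral_integral_swap hmod
  have ha : 0 ≤ ((t / 2 : ℝ) * sqrtSymbol ξ).re := by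
    rw [Complex.re_ofReal_mul]
    exact mul_nonneg (by positivity) (sqrtSymbol_re_nonneg ξ)
  have hsq : ((t / 2 : ℝ) * sqrtSymbol ξ) ^ 2 =
      ((-(t ^ 2 / 2 * Real.pi * ξ) : ℝ) : ℂ) * Complex.I := by
    rw [mul_pow, sqrtSymbol_sq]
    push_cast
    ring
  have hsub := integral_exp_neg_div_sqrt_mul_cexp_sq ha (by rw [hsq, Complex.re_ofReal_mul]; simp)
  have hpi : (√Real.pi : ℂ) ≠ 0 := by
    exact_mod_cast (Real.sqrt_pos.2 Real.pi_pos).ne'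
  calc FT (fun x => poissonP f t x) ξ
      = (√Real.pi : ℂ)⁻¹ * ∫ x : ℝ, ∫ u in Ioi (0 : ℝ),
          Complex.exp (-(2 * (Real.pi : ℂ) * Complex.I * (x : ℂ) * (ξ : ℂ))) *
            (((Real.exp (-u) / √u : ℝ) : ℂ) * f (x + t ^ 2 / (4 * u))) := by
        rw [FT, ← integral_const_mul]
        refine integral_congr_ae (.of_forall fun x => ?_)
        simp only [poissonP]
        rw [integral_const_mul]
        push_cast
        ring
    _ = (√Real.pi : ℂ)⁻¹ * ∫ u in Ioi (0 : ℝ), ((Real.exp (-u) / √u : ℝ) : ℂ) *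
          Complex.exp (-((t / 2 : ℝ) * sqrtSymbol ξ) ^ 2 / u) * FT f ξ := by
        rw [← hfub]
        congr 1
        refine integral_congr_ae (.of_forall fun u => ?_)
        have hexp : Complex.exp (-((t / 2 : ℝ) * sqrtSymbol ξ) ^ 2 / u) =
            Complex.exp (2 * Real.pi * Complex.I * (t ^ 2 / (4 * u) : ℝ) * ξ) := by
          rw [hsq]
          congr 1
          push_cast
          ring
        simp only
        rw [hexp, mul_assoc _ _ (FT f ξ), ← FT_comp_add_right, FT, ← integral_const_mul]
        refine integral_congr_ae (.of_forall fun x => ?_)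
        ring
    _ = Complex.exp (-(t : ℂ) * sqrtSymbol ξ) * FT f ξ := by
        rw [integral_mul_const, hsub, mul_assoc, inv_mul_cancel_left₀ hpi]
        congr 2
        push_cast
        ring
end

section
/- There exists a constant C > 0 such that |φ(x)| ≤ C·(1+|x|)^{−3/2} for all x ∈ ℝ. -/
open MeasureTheory

open Set Filter Topology

/-- The oscillating factor `e^{iyu²}`. -/
noncomputable def chirp (y u : ℝ) : ℂ := Complex.exp (((y * u ^ 2 : ℝ) : ℂ) * Complex.I)

lemma norm_chirp (y u : ℝ) : ‖chirp y u‖ = 1 := Complex.norm_exp_ofReal_mul_I _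

lemma continuous_chirp (y : ℝ) : Continuous (chirp y) := by
  unfold chirp
  fun_prop

lemma hasDerivAt_chirp (y u : ℝ) :
    HasDerivAt (chirp y) (2 * Complex.I * y * u * chirp y u) u := by
  have h1 : HasDerivAt (fun u : ℝ => y * u ^ 2) (y * (2 * u)) u := by
    simpa using (hasDerivAt_pow 2 u).const_mul y
  have h2 := (h1.ofReal_comp.mul_const Complex.I).cexp
  refine h2.congr_deriv ?_
  unfold chirp
  push_cast
  ring

lemma IntegrableOn.mul_chirp {f : ℝ → ℂ} {s : Set ℝ} (hf : IntegrableOn f s) (y : ℝ) :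
    IntegrableOn (fun u => f u * chirp y u) s :=
  hf.mul_bdd (c := 1) (continuous_chirp y).aestronglyMeasurable
    (.of_forall fun u => (norm_chirp y u).le)

lemma norm_setIntegral_mul_chirp_le (f : ℝ → ℂ) (s : Set ℝ) (y : ℝ) :
    ‖∫ u in s, f u * chirp y u‖ ≤ ∫ u in s, ‖f u‖ := by
  refine (norm_integral_le_integral_norm _).trans_eq ?_
  simp [norm_chirp]

lemma integrableOn_inv_sq_Ioi {δ : ℝ} (hδ : 0 < δ) :
    IntegrableOn (fun u : ℝ => (u ^ 2)⁻¹) (Ioi δ) := by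
  refine (integrableOn_Ioi_rpow_of_lt (a := -2) (by norm_num) hδ).congr_fun
    (fun u hu => ?_) measurableSet_Ioi
  have hu : 0 < u := hδ.trans hu
  simp only [Real.rpow_neg hu.le, Real.rpow_two]

lemma integral_inv_sq_Ioi {δ : ℝ} (hδ : 0 < δ) :
    ∫ u in Ioi δ, (u ^ 2)⁻¹ = δ⁻¹ := by
  have h : ∫ u in Ioi δ, (u ^ 2)⁻¹ = ∫ u in Ioi δ, u ^ (-2 : ℝ) := by
    refine setIntegral_congr_fun measurableSet_Ioi fun u hu => ?_
    have hu : 0 < u := hδ.trans hu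
    simp only [Real.rpow_neg hu.le, Real.rpow_two]
  rw [h, integral_Ioi_rpow_of_lt (by norm_num) hδ]
  norm_num [Real.rpow_neg_one]

/-- The tail part of van der Corput's second derivative estimate for the phase `yu²`. -/
lemma norm_integral_Ioi_mul_chirp_le {g g' : ℝ → ℂ} (hg : ∀ u, HasDerivAt g (g' u) u)
    {M : ℝ} (hM : ∀ u, 0 ≤ u → ‖g u‖ ≤ M) (hgi : IntegrableOn g (Ioi 0))
    (hg'i : IntegrableOn g' (Ioi 0)) {δ : ℝ} (hδ : 0 < δ) (y : ℝ) :
    2 * |y| * ‖∫ u in Ioi δ, g u * chirp y u‖ ≤ (2 * M + ∫ u in Ioi 0, ‖g' u‖) / δ := by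
  have hsub : Ioi δ ⊆ Ioi (0 : ℝ) := Ioi_subset_Ioi hδ.le
  have hgc : Continuous g := continuous_iff_continuousAt.2 fun u => (hg u).continuousAt
  have hM0 : 0 ≤ M := (norm_nonneg _).trans (hM 0 le_rfl)
  have hinv : ∀ u ∈ Ioi δ, ‖((u : ℂ))⁻¹‖ ≤ δ⁻¹ := fun u hu => by
    rw [norm_inv, Complex.norm_real, Real.norm_of_nonneg (hδ.trans hu).le]
    exact inv_anti₀ hδ (le_of_lt hu)
  have hinvm : AEStronglyMeasurable (fun u : ℝ => ((u : ℂ))⁻¹) (volume.restrict (Ioi δ)) :=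
    (Complex.measurable_ofReal.inv).aestronglyMeasurable
  have hA : IntegrableOn (fun u : ℝ => g' u * (u : ℂ)⁻¹) (Ioi δ) :=
    (hg'i.mono_set hsub).mul_bdd (c := δ⁻¹) hinvm
      ((ae_restrict_iff' measurableSet_Ioi).2 (.of_forall hinv))
  have hBle : ∀ u ∈ Ioi δ, ‖g u * ((u : ℂ) ^ 2)⁻¹‖ ≤ M * (u ^ 2)⁻¹ := fun u hu => by
    rw [norm_mul, norm_inv, norm_pow, Complex.norm_real, Real.norm_eq_abs, sq_abs]
    have := hM u (hδ.trans hu).le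
    gcongr
  have hB : IntegrableOn (fun u : ℝ => g u * ((u : ℂ) ^ 2)⁻¹) (Ioi δ) := by
    refine Integrable.mono' ((integrableOn_inv_sq_Ioi hδ).const_mul M) ?_
      ((ae_restrict_iff' measurableSet_Ioi).2 (.of_forall hBle))
    exact (hgc.measurable.mul ((Complex.measurable_ofReal.pow_const 2).inv)).aestronglyMeasurable
  have hC : IntegrableOn (fun u => g u * chirp y u) (Ioi δ) :=
    IntegrableOn.mul_chirp (hgi.mono_set hsub) y
  have hD := IntegrableOn.mul_chirp (hA.sub hB) y
  have hderiv : ∀ u ∈ Ici δ, HasDerivAt (fun u : ℝ => g u * (u : ℂ)⁻¹ * chirp y u)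
      ((g' u * (u : ℂ)⁻¹ - g u * ((u : ℂ) ^ 2)⁻¹) * chirp y u
        + 2 * Complex.I * y * (g u * chirp y u)) u := fun u hu => by
    have hu0 : (u : ℂ) ≠ 0 := by exact_mod_cast (hδ.trans_le hu).ne'
    have h1 : HasDerivAt (fun u : ℝ => (u : ℂ)⁻¹) (-1 / (u : ℂ) ^ 2) u :=
      (Complex.ofRealCLM.hasDerivAt (x := u)).fun_inv hu0
    refine (((hg u).fun_mul h1).fun_mul (hasDerivAt_chirp y u)).congr_deriv ?_
    field_simp
    ring
  have hlim : Tendsto (fun u : ℝ => g u * (u : ℂ)⁻¹ * chirp y u) atTop (𝓝 0) := by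
    refine squeeze_zero_norm' (a := fun u => M * u⁻¹) ?_
      (by simpa using tendsto_inv_atTop_zero.const_mul M)
    filter_upwards [eventually_gt_atTop 0] with u hu
    rw [norm_mul, norm_chirp, norm_mul, norm_inv, Complex.norm_real, Real.norm_of_nonneg hu.le,
      mul_one]
    have := hM u hu.le
    gcongr
  have key := integral_Ioi_of_hasDerivAt_of_tendsto' hderiv
    (hD.add (hC.const_mul (2 * Complex.I * y))) hlim
  have hsplit := integral_add hD (hC.const_mul (2 * Complex.I * y))
  simp only [Pi.sub_apply] at hsplit
  rw [hsplit, integral_const_mul] at key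
  have hnorm : 2 * |y| * ‖∫ u in Ioi δ, g u * chirp y u‖
      = ‖2 * Complex.I * y * ∫ u in Ioi δ, g u * chirp y u‖ := by
    simp
  have hI : ‖∫ u in Ioi δ, (g' u * (u : ℂ)⁻¹ - g u * ((u : ℂ) ^ 2)⁻¹) * chirp y u‖
      ≤ (∫ u in Ioi 0, ‖g' u‖) * δ⁻¹ + M * δ⁻¹ := by
    refine (norm_setIntegral_mul_chirp_le _ _ _).trans ?_
    have hE : IntegrableOn (fun u => ‖g' u‖ * δ⁻¹) (Ioi δ) :=
      (hg'i.mono_set hsub).norm.mul_const _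
    have hF := (integrableOn_inv_sq_Ioi hδ).const_mul M
    calc ∫ u in Ioi δ, ‖g' u * (u : ℂ)⁻¹ - g u * ((u : ℂ) ^ 2)⁻¹‖
        ≤ ∫ u in Ioi δ, (‖g' u‖ * δ⁻¹ + M * (u ^ 2)⁻¹) := by
          refine setIntegral_mono_on (hA.sub hB).norm (hE.add hF) measurableSet_Ioi fun u hu => ?_
          refine (norm_sub_le _ _).trans (add_le_add ?_ (hBle u hu))
          rw [norm_mul]
          exact mul_le_mul_of_nonneg_left (hinv u hu) (norm_nonneg _)
      _ = (∫ u in Ioi δ, ‖g' u‖) * δ⁻¹ + M * δ⁻¹ := by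
          rw [integral_add hE hF, integral_mul_const, integral_const_mul, integral_inv_sq_Ioi hδ]
      _ ≤ _ := by
          gcongr
          · exact ae_of_all _ fun u => norm_nonneg _
          · exact hg'i.norm
  have hbd : ‖g δ * (δ : ℂ)⁻¹ * chirp y δ‖ ≤ M * δ⁻¹ := by
    rw [norm_mul, norm_chirp, norm_mul, norm_inv, Complex.norm_real, Real.norm_of_nonneg hδ.le,
      mul_one]
    have := hM δ hδ.le
    gcongr
  rw [hnorm, eq_sub_of_add_eq' key]
  refine (norm_sub_le _ _).trans ?_
  rw [zero_sub, norm_neg]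
  calc _ ≤ M * δ⁻¹ + ((∫ u in Ioi 0, ‖g' u‖) * δ⁻¹ + M * δ⁻¹) := add_le_add hbd hI
    _ = _ := by ring

lemma norm_integral_Ioi_zero_mul_chirp_le {g g' : ℝ → ℂ} (hg : ∀ u, HasDerivAt g (g' u) u)
    {M : ℝ} (hM : ∀ u, 0 ≤ u → ‖g u‖ ≤ M) (hgi : IntegrableOn g (Ioi 0))
    (hg'i : IntegrableOn g' (Ioi 0)) {y : ℝ} (hy : y ≠ 0) :
    ‖∫ u in Ioi 0, g u * chirp y u‖ ≤ (2 * M + ∫ u in Ioi 0, ‖g' u‖) / √|y| := by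
  set N := ∫ u in Ioi 0, ‖g' u‖
  have hN : 0 ≤ N := integral_nonneg fun u => norm_nonneg _
  set r := √|y|
  have hr : 0 < r := Real.sqrt_pos.2 (abs_pos.2 hy)
  have hr2 : |y| = r * r := (Real.mul_self_sqrt (abs_nonneg y)).symm
  have hδ : 0 < r⁻¹ := inv_pos.2 hr
  have htail := norm_integral_Ioi_mul_chirp_le hg hM hgi hg'i hδ y
  have hnear : ‖∫ u in Ioc 0 r⁻¹, g u * chirp y u‖ ≤ M * r⁻¹ := by
    refine (norm_setIntegral_le_of_norm_le_const (C := M) (by simp) fun u hu => ?_).trans_eq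
      (by simp [hr.le])
    rw [norm_mul, norm_chirp, mul_one]
    exact hM u hu.1.le
  have hfi := IntegrableOn.mul_chirp hgi y
  rw [← Ioc_union_Ioi_eq_Ioi hδ.le, setIntegral_union (Ioc_disjoint_Ioi le_rfl) measurableSet_Ioi
    (hfi.mono_set Ioc_subset_Ioi_self) (hfi.mono_set (Ioi_subset_Ioi hδ.le))]
  refine (norm_add_le _ _).trans ?_
  rw [hr2, div_inv_eq_mul] at htail
  rw [le_div_iff₀ hr, add_mul]
  have h1 : ‖∫ u in Ioc 0 r⁻¹, g u * chirp y u‖ * r ≤ M := by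
    calc _ ≤ M * r⁻¹ * r := by gcongr
      _ = M := by field_simp
  have h2 : 2 * (‖∫ u in Ioi r⁻¹, g u * chirp y u‖ * r) ≤ 2 * M + N := by
    refine le_of_mul_le_mul_right ?_ hr
    linarith
  linarith

lemma integrableOn_pow_mul_cexp {a : ℂ} (ha : 0 < a.re) (n : ℕ) :
    IntegrableOn (fun u : ℝ => (u : ℂ) ^ n * Complex.exp (-a * u)) (Ioi 0) := by
  have h := integrableOn_rpow_mul_exp_neg_mul_rpow (p := 1) (s := n) (b := a.re)
    (by linarith [n.cast_nonneg (α := ℝ)]) one_pos ha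
  refine Integrable.mono' h (Continuous.aestronglyMeasurable (by fun_prop)) ?_
  refine (ae_restrict_iff' measurableSet_Ioi).2 (.of_forall fun u hu => ?_)
  simp [Complex.norm_exp, abs_of_pos (show 0 < u from hu)]

lemma integrableOn_one_sub_mul_cexp {a : ℂ} (ha : 0 < a.re) :
    IntegrableOn (fun u : ℝ => (1 - a * u) * Complex.exp (-a * u)) (Ioi 0) := by
  refine ((integrableOn_pow_mul_cexp ha 0).sub
    ((integrableOn_pow_mul_cexp ha 1).const_mul a)).congr (.of_forall fun u => ?_)
  simp only [Pi.sub_apply]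
  ring

lemma hasDerivAt_cexp_neg_mul_ofReal (a : ℂ) (u : ℝ) :
    HasDerivAt (fun u : ℝ => Complex.exp (-a * u)) (-a * Complex.exp (-a * u)) u := by
  have h : HasDerivAt (fun u : ℝ => -a * (u : ℂ)) (-a * 1) u :=
    (Complex.ofRealCLM.hasDerivAt (x := u)).const_mul (-a)
  exact h.cexp.congr_deriv (by ring)

lemma norm_ofReal_mul_cexp_le {a : ℂ} (ha : 0 < a.re) {u : ℝ} (hu : 0 ≤ u) :
    ‖(u : ℂ) * Complex.exp (-a * u)‖ ≤ 1 / a.re := by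
  have h : a.re * u ≤ Real.exp (a.re * u) := by linarith [Real.add_one_le_exp (a.re * u)]
  rw [norm_mul, Complex.norm_real, Real.norm_of_nonneg hu, Complex.norm_exp, le_div_iff₀ ha]
  simp only [neg_mul, Complex.neg_re, Complex.re_mul_ofReal, Real.exp_neg]
  rw [mul_right_comm, mul_comm u, ← div_eq_mul_inv]
  exact (div_le_one (Real.exp_pos _)).2 h

lemma two_I_mul_integral_sq_mul_cexp_mul_chirp {a : ℂ} (ha : 0 < a.re) (y : ℝ) :
    2 * Complex.I * y * ∫ u in Ioi (0 : ℝ), (u : ℂ) ^ 2 * Complex.exp (-a * u) * chirp y u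
      = -∫ u in Ioi (0 : ℝ), (1 - a * u) * Complex.exp (-a * u) * chirp y u := by
  have hA := integrableOn_one_sub_mul_cexp ha
  have hA' := IntegrableOn.mul_chirp hA y
  have hB := (IntegrableOn.mul_chirp (integrableOn_pow_mul_cexp ha 2) y).const_mul
    (2 * Complex.I * y)
  have hderiv : ∀ u ∈ Ici (0 : ℝ),
      HasDerivAt (fun u : ℝ => (u : ℂ) * Complex.exp (-a * u) * chirp y u)
        ((1 - a * u) * Complex.exp (-a * u) * chirp y u
          + 2 * Complex.I * y * ((u : ℂ) ^ 2 * Complex.exp (-a * u) * chirp y u)) u :=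
    fun u _ => by
      have h1 : HasDerivAt (fun u : ℝ => (u : ℂ)) 1 u := Complex.ofRealCLM.hasDerivAt
      refine ((h1.fun_mul (hasDerivAt_cexp_neg_mul_ofReal a u)).fun_mul
        (hasDerivAt_chirp y u)).congr_deriv ?_
      ring
  have hlim : Tendsto (fun u : ℝ => (u : ℂ) * Complex.exp (-a * u) * chirp y u) atTop (𝓝 0) := by
    have h := tendsto_rpow_mul_exp_neg_mul_atTop_nhds_zero 1 a.re ha
    refine squeeze_zero_norm' ?_ h
    filter_upwards [eventually_ge_atTop 0] with u hu
    rw [norm_mul, norm_chirp]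
    simp [Complex.norm_exp, abs_of_nonneg hu]
  have key := integral_Ioi_of_hasDerivAt_of_tendsto' hderiv (hA'.add hB) hlim
  rw [integral_add hA' hB, integral_const_mul] at key
  refine eq_neg_of_add_eq_zero_right (key.trans ?_)
  simp

lemma exists_norm_integral_sq_mul_cexp_mul_chirp_le {a : ℂ} (ha : 0 < a.re) :
    ∃ K : ℝ, 0 ≤ K ∧ ∀ y : ℝ, y ≠ 0 →
      ‖∫ u in Ioi (0 : ℝ), (u : ℂ) ^ 2 * Complex.exp (-a * u) * chirp y u‖
        ≤ K * |y| ^ (-(3 : ℝ) / 2) := by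
  set g' : ℝ → ℂ := fun u => (a ^ 2 * u - 2 * a) * Complex.exp (-a * u)
  have hg : ∀ u : ℝ, HasDerivAt (fun u : ℝ => (1 - a * u) * Complex.exp (-a * u)) (g' u) u := by
    intro u
    have h1 : HasDerivAt (fun u : ℝ => 1 - a * (u : ℂ)) (-(a * 1)) u :=
      ((Complex.ofRealCLM.hasDerivAt (x := u)).const_mul a).const_sub 1
    refine (h1.fun_mul (hasDerivAt_cexp_neg_mul_ofReal a u)).congr_deriv ?_
    simp only [g']
    ring
  have hM : ∀ u : ℝ, 0 ≤ u → ‖(1 - a * u) * Complex.exp (-a * u)‖ ≤ 1 + ‖a‖ * (1 / a.re) := by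
    intro u hu
    rw [sub_mul, one_mul, mul_assoc]
    refine (norm_sub_le _ _).trans (add_le_add ?_ ?_)
    · rw [Complex.norm_exp]
      simp only [neg_mul, Complex.neg_re, Complex.re_mul_ofReal, Real.exp_le_one_iff]
      linarith [mul_nonneg ha.le hu]
    · rw [norm_mul]
      exact mul_le_mul_of_nonneg_left (norm_ofReal_mul_cexp_le ha hu) (norm_nonneg _)
  have hgi := integrableOn_one_sub_mul_cexp ha
  have hg'i : IntegrableOn g' (Ioi 0) := by
    refine (((integrableOn_pow_mul_cexp ha 1).const_mul (a ^ 2)).sub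
      ((integrableOn_pow_mul_cexp ha 0).const_mul (2 * a))).congr (.of_forall fun u => ?_)
    simp only [Pi.sub_apply, g']
    ring
  set L := 2 * (1 + ‖a‖ * (1 / a.re)) + ∫ u in Ioi 0, ‖g' u‖
  have hL : 0 ≤ L := by
    have : 0 ≤ ∫ u in Ioi 0, ‖g' u‖ := integral_nonneg fun u => norm_nonneg _
    positivity
  refine ⟨L / 2, by positivity, fun y hy => ?_⟩
  have hy' : 0 < |y| := abs_pos.2 hy
  have h : _ ≤ L / √|y| := norm_integral_Ioi_zero_mul_chirp_le hg hM hgi hg'i hy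
  rw [← norm_neg, ← two_I_mul_integral_sq_mul_cexp_mul_chirp ha y, norm_mul] at h
  have h2 : ‖(2 * Complex.I * y : ℂ)‖ = 2 * |y| := by simp
  have hpow : |y| ^ (-(3 : ℝ) / 2) = 1 / (|y| * √|y|) := by
    rw [neg_div, Real.rpow_neg hy'.le, show (3 : ℝ) / 2 = 1 + 1 / 2 by norm_num,
      Real.rpow_add hy', Real.rpow_one, ← Real.sqrt_eq_rpow, one_div]
  rw [h2, ← le_div_iff₀' (by positivity)] at h
  refine h.trans_eq ?_
  rw [hpow]
  field_simp

lemma exists_norm_integral_sq_mul_cexp_mul_chirp_le_one_add {a : ℂ} (ha : 0 < a.re) :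
    ∃ K : ℝ, 0 ≤ K ∧ ∀ y : ℝ,
      ‖∫ u in Ioi (0 : ℝ), (u : ℂ) ^ 2 * Complex.exp (-a * u) * chirp y u‖
        ≤ K * (1 + |y|) ^ (-(3 : ℝ) / 2) := by
  obtain ⟨K, hK, hKy⟩ := exists_norm_integral_sq_mul_cexp_mul_chirp_le ha
  set B := ∫ u in Ioi (0 : ℝ), ‖(u : ℂ) ^ 2 * Complex.exp (-a * u)‖
  have hB : 0 ≤ B := integral_nonneg fun u => norm_nonneg _
  have hhalf : ∀ y : ℝ, ((1 + |y|) / 2) ^ (-(3 : ℝ) / 2)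
      = 2 ^ ((3 : ℝ) / 2) * (1 + |y|) ^ (-(3 : ℝ) / 2) := fun y => by
    rw [Real.div_rpow (by positivity) (by norm_num), neg_div, Real.rpow_neg (x := 2) (by norm_num),
      div_inv_eq_mul, mul_comm]
  refine ⟨(B + K) * 2 ^ ((3 : ℝ) / 2), by positivity, fun y => ?_⟩
  rw [mul_assoc, ← hhalf, add_mul]
  have hpos : 0 < (1 + |y|) / 2 := by positivity
  rcases le_total |y| 1 with hy | hy
  · have h1 : 1 ≤ ((1 + |y|) / 2) ^ (-(3 : ℝ) / 2) :=
      Real.one_le_rpow_of_pos_of_le_one_of_nonpos hpos (by linarith) (by norm_num)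
    have h2 := norm_setIntegral_mul_chirp_le
      (fun u : ℝ => (u : ℂ) ^ 2 * Complex.exp (-a * u)) (Ioi 0) y
    calc _ ≤ B := h2
      _ ≤ B * ((1 + |y|) / 2) ^ (-(3 : ℝ) / 2) := le_mul_of_one_le_right hB h1
      _ ≤ _ := le_add_of_nonneg_right (by positivity)
  · calc _ ≤ K * |y| ^ (-(3 : ℝ) / 2) := hKy y (abs_pos.1 (by linarith))
      _ ≤ K * ((1 + |y|) / 2) ^ (-(3 : ℝ) / 2) := by
        gcongr ?_ * ?_
        exact Real.rpow_le_rpow_of_nonpos hpos (by linarith) (by norm_num)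
      _ ≤ _ := le_add_of_nonneg_left (by positivity)

/-- The substitution `ξ = u²`. -/
lemma integral_sqrt_mul_cexp_eq (a : ℂ) (y : ℝ) :
    ∫ ξ in Ioi (0 : ℝ), Complex.exp (((y * ξ : ℝ) : ℂ) * Complex.I)
        * (-(a * √ξ) * Complex.exp (-(a * √ξ)))
      = -2 * a * ∫ u in Ioi (0 : ℝ), (u : ℂ) ^ 2 * Complex.exp (-a * u) * chirp y u := by
  rw [← integral_comp_rpow_Ioi_of_pos (p := 2) (by norm_num), ← integral_const_mul]
  refine setIntegral_congr_fun measurableSet_Ioi fun u hu => ?_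
  have hu : 0 < u := hu
  simp only [Real.rpow_two, Real.sqrt_sq hu.le, chirp, Complex.real_smul,
    show (2 : ℝ) - 1 = 1 by norm_num, Real.rpow_one]
  push_cast
  ring_nf

/-- The value of `√(−2πi)`. -/
noncomputable def sqrtCoeff : ℂ :=
  (√(2 * Real.pi) : ℂ) * Complex.exp (-(Real.pi / 4 : ℝ) * Complex.I)

lemma sqrtCoeff_re_pos : 0 < sqrtCoeff.re := by
  have h : sqrtCoeff.re = √(2 * Real.pi) * Real.cos (-(Real.pi / 4)) := by
    rw [sqrtCoeff, Complex.re_ofReal_mul, ← Complex.ofReal_neg, Complex.exp_ofReal_mul_I_re]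
  rw [h, Real.cos_neg, Real.cos_pi_div_four]
  positivity

lemma sqrtSymbol_of_pos {ξ : ℝ} (hξ : 0 < ξ) : sqrtSymbol ξ = sqrtCoeff * √ξ := by
  rw [sqrtSymbol, sqrtCoeff, Real.sign_of_pos hξ, abs_of_pos hξ, Real.sqrt_mul (by positivity)]
  push_cast
  ring_nf

lemma sqrtSymbol_neg_of_pos {ξ : ℝ} (hξ : 0 < ξ) :
    sqrtSymbol (-ξ) = (starRingEnd ℂ) sqrtCoeff * √ξ := by
  rw [sqrtSymbol, sqrtCoeff, Real.sign_of_neg (neg_lt_zero.2 hξ), abs_neg, abs_of_pos hξ,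
    Real.sqrt_mul (by positivity), map_mul, Complex.conj_ofReal, ← Complex.exp_conj, map_mul,
    map_neg, Complex.conj_ofReal, Complex.conj_I]
  push_cast
  ring_nf

lemma norm_phi_le (x : ℝ) :
    ‖phi x‖ ≤ ‖∫ ξ in Ioi (0 : ℝ), Complex.exp (((2 * Real.pi * x * ξ : ℝ) : ℂ) * Complex.I)
          * (-(sqrtCoeff * √ξ) * Complex.exp (-(sqrtCoeff * √ξ)))‖
      + ‖∫ ξ in Ioi (0 : ℝ), Complex.exp (((-(2 * Real.pi * x) * ξ : ℝ) : ℂ) * Complex.I)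
          * (-((starRingEnd ℂ) sqrtCoeff * √ξ)
            * Complex.exp (-((starRingEnd ℂ) sqrtCoeff * √ξ)))‖ := by
  unfold phi
  by_cases hfi : Integrable (fun ξ : ℝ =>
      Complex.exp (2 * (Real.pi : ℂ) * Complex.I * (x : ℂ) * (ξ : ℂ)) * phiHat ξ)
  · rw [← intervalIntegral.integral_Iic_add_Ioi (b := 0) hfi.integrableOn hfi.integrableOn,
      add_comm]
    refine (norm_add_le _ _).trans_eq ?_
    congr 2
    · refine setIntegral_congr_fun measurableSet_Ioi fun ξ hξ => ?_
      simp only [phiHat, sqrtSymbol_of_pos hξ]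
      push_cast
      ring_nf
    · rw [← neg_zero, ← integral_comp_neg_Ioi, neg_zero]
      refine setIntegral_congr_fun measurableSet_Ioi fun ξ hξ => ?_
      simp only [phiHat, sqrtSymbol_neg_of_pos hξ]
      push_cast
      ring_nf
  · rw [integral_undef hfi, norm_zero]
    positivity

/-- `|φ(x)| ≤ C·(1+|x|)^{−3/2}` for all `x ∈ ℝ`. -/
theorem phi_decay :
    ∃ C : ℝ, 0 < C ∧ ∀ x : ℝ, ‖phi x‖ ≤ C * (1 + |x|) ^ (-(3 : ℝ) / 2) := by
  obtain ⟨K₁, hK₁, h₁⟩ :=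
    exists_norm_integral_sq_mul_cexp_mul_chirp_le_one_add sqrtCoeff_re_pos
  obtain ⟨K₂, hK₂, h₂⟩ :=
    exists_norm_integral_sq_mul_cexp_mul_chirp_le_one_add (a := (starRingEnd ℂ) sqrtCoeff)
      (by simpa using sqrtCoeff_re_pos)
  refine ⟨2 * ‖sqrtCoeff‖ * (K₁ + K₂) + 1, by positivity, fun x => ?_⟩
  have hscale : (1 + |2 * Real.pi * x|) ^ (-(3 : ℝ) / 2) ≤ (1 + |x|) ^ (-(3 : ℝ) / 2) := by
    refine Real.rpow_le_rpow_of_nonpos (by positivity) ?_ (by norm_num)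
    rw [abs_mul, abs_of_pos Real.two_pi_pos]
    nlinarith [abs_nonneg x, Real.pi_gt_three]
  have hx₁ := (h₁ (2 * Real.pi * x)).trans (mul_le_mul_of_nonneg_left hscale hK₁)
  have hx₂ := h₂ (-(2 * Real.pi * x))
  rw [abs_neg] at hx₂
  replace hx₂ := hx₂.trans (mul_le_mul_of_nonneg_left hscale hK₂)
  have h := norm_phi_le x
  rw [integral_sqrt_mul_cexp_eq, integral_sqrt_mul_cexp_eq, norm_mul (-2 * sqrtCoeff),
    norm_mul (-2 * (starRingEnd ℂ) sqrtCoeff)] at h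
  have e₁ : ‖-2 * sqrtCoeff‖ = 2 * ‖sqrtCoeff‖ := by simp
  have e₂ : ‖-2 * (starRingEnd ℂ) sqrtCoeff‖ = 2 * ‖sqrtCoeff‖ := by simp
  rw [e₁, e₂] at h
  have hc : 0 ≤ 2 * ‖sqrtCoeff‖ := by positivity
  have hp : 0 ≤ (1 + |x|) ^ (-(3 : ℝ) / 2) := by positivity
  calc ‖phi x‖ ≤ _ := h
    _ ≤ 2 * ‖sqrtCoeff‖ * (K₁ * (1 + |x|) ^ (-(3 : ℝ) / 2))
        + 2 * ‖sqrtCoeff‖ * (K₂ * (1 + |x|) ^ (-(3 : ℝ) / 2)) :=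
      add_le_add (mul_le_mul_of_nonneg_left hx₁ hc) (mul_le_mul_of_nonneg_left hx₂ hc)
    _ ≤ _ := by linarith
end

section
/- The function φ is continuously differentiable on ℝ and there exists a constant C > 0 such that |φ'(x)| ≤ C·(1+|x|)^{−5/2} for all x ∈ ℝ. -/
open MeasureTheory

/-- The integrand `ξ^α · e^{−c√ξ + iyξ}`. -/
noncomputable def oscIntegrand (c : ℂ) (α y ξ : ℝ) : ℂ :=
  ((ξ ^ α : ℝ) : ℂ) * Complex.exp (-c * (Real.sqrt ξ : ℂ) + Complex.I * y * ξ)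

/-- The half-line oscillatory integral `∫₀^∞ ξ^α · e^{−c√ξ + iyξ} dξ`. -/
noncomputable def oscIntegral (c : ℂ) (α y : ℝ) : ℂ :=
  ∫ ξ in Set.Ioi (0 : ℝ), oscIntegrand c α y ξ

lemma norm_oscIntegrand (c : ℂ) (α y : ℝ) {ξ : ℝ} (hξ : 0 ≤ ξ) :
    ‖oscIntegrand c α y ξ‖ = ξ ^ α * Real.exp (-c.re * Real.sqrt ξ) := by
  have h : (-c * (Real.sqrt ξ : ℂ) + Complex.I * y * ξ).re = -c.re * Real.sqrt ξ := by
    simp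
  rw [oscIntegrand, norm_mul, Complex.norm_exp, h, Complex.norm_real, Real.norm_eq_abs,
    abs_of_nonneg (Real.rpow_nonneg hξ α)]

lemma norm_oscIntegrand_le {c : ℂ} (hc : 0 < c.re) (α y : ℝ) {ξ : ℝ} (hξ : 0 ≤ ξ) :
    ‖oscIntegrand c α y ξ‖ ≤ ξ ^ α := by
  rw [norm_oscIntegrand c α y hξ]
  refine mul_le_of_le_one_right (Real.rpow_nonneg hξ α) (Real.exp_le_one_iff.2 ?_)
  nlinarith [mul_nonneg hc.le (Real.sqrt_nonneg ξ)]

lemma measurable_oscIntegrand (c : ℂ) (α y : ℝ) : Measurable (oscIntegrand c α y) := by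
  unfold oscIntegrand
  fun_prop

lemma integrableOn_rpow_mul_exp_neg_mul_sqrt {r α : ℝ} (hr : 0 < r) (hα : -1 < α) :
    IntegrableOn (fun ξ : ℝ => ξ ^ α * Real.exp (-r * Real.sqrt ξ)) (Set.Ioi 0) := by
  refine Integrable.of_integral_ne_zero ?_
  simp_rw [Real.sqrt_eq_rpow]
  rw [integral_rpow_mul_exp_neg_mul_rpow (by norm_num) hα hr]
  have : 0 < Real.Gamma ((α + 1) / (1 / 2)) := Real.Gamma_pos_of_pos (by linarith)
  positivity

lemma integrableOn_oscIntegrand {c : ℂ} (hc : 0 < c.re) {α : ℝ} (hα : -1 < α) (y : ℝ) :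
    IntegrableOn (oscIntegrand c α y) (Set.Ioi 0) := by
  refine Integrable.mono' (integrableOn_rpow_mul_exp_neg_mul_sqrt hc hα)
    (measurable_oscIntegrand c α y).aestronglyMeasurable ?_
  filter_upwards [ae_restrict_mem measurableSet_Ioi] with ξ hξ
  exact (norm_oscIntegrand c α y (le_of_lt hξ)).le

lemma hasDerivAt_oscIntegrand (c : ℂ) (α y : ℝ) {ξ : ℝ} (hξ : 0 < ξ) :
    HasDerivAt (oscIntegrand c α y)
      (α * oscIntegrand c (α - 1) y ξ - c / 2 * oscIntegrand c (α - 1 / 2) y ξ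
        + Complex.I * y * oscIntegrand c α y ξ) ξ := by
  have h1 : HasDerivAt (fun x : ℝ => ((x ^ α : ℝ) : ℂ)) ((α * ξ ^ (α - 1) : ℝ) : ℂ) ξ :=
    (Real.hasDerivAt_rpow_const (Or.inl hξ.ne')).ofReal_comp
  have h2 : HasDerivAt (fun x : ℝ => (Real.sqrt x : ℂ)) ((1 / (2 * Real.sqrt ξ) : ℝ) : ℂ) ξ :=
    (Real.hasDerivAt_sqrt hξ.ne').ofReal_comp
  have h3 : HasDerivAt (fun x : ℝ => (x : ℂ)) 1 ξ := (hasDerivAt_id ξ).ofReal_comp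
  have h4 := h1.mul ((h2.const_mul (-c)).add (h3.const_mul (Complex.I * y))).cexp
  refine h4.congr_deriv ?_
  have e : ξ ^ (α - 1 / 2) = ξ ^ α * (Real.sqrt ξ)⁻¹ := by
    rw [Real.rpow_sub hξ, Real.sqrt_eq_rpow, div_eq_mul_inv]
  simp only [oscIntegrand, e]
  push_cast
  have hs : (Real.sqrt ξ : ℂ) ≠ 0 := by exact_mod_cast (Real.sqrt_pos.2 hξ).ne'
  simp only [Pi.add_apply]
  field_simp
  ring

lemma integral_Ioi_oscIntegrand_by_parts {c : ℂ} {α y a : ℝ} (ha : 0 ≤ a) (h0 : 0 < a ∨ 0 ≤ α)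
    (h1 : IntegrableOn (fun ξ => (α : ℂ) * oscIntegrand c (α - 1) y ξ) (Set.Ioi a))
    (h2 : IntegrableOn (oscIntegrand c (α - 1 / 2) y) (Set.Ioi a))
    (h3 : IntegrableOn (oscIntegrand c α y) (Set.Ioi a)) :
    Complex.I * y * ∫ ξ in Set.Ioi a, oscIntegrand c α y ξ =
      -oscIntegrand c α y a - α * (∫ ξ in Set.Ioi a, oscIntegrand c (α - 1) y ξ)
        + c / 2 * ∫ ξ in Set.Ioi a, oscIntegrand c (α - 1 / 2) y ξ := by
  have hd : ∀ ξ ∈ Set.Ioi a, HasDerivAt (oscIntegrand c α y) _ ξ := fun ξ hξ =>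
    hasDerivAt_oscIntegrand c α y (ha.trans_lt hξ)
  have hint := (h1.sub (h2.const_mul (c / 2))).add (h3.const_mul (Complex.I * y))
  have hcont : ContinuousAt (oscIntegrand c α y) a := by
    have := Real.continuousAt_rpow_const a α (h0.imp (fun h => h.ne') id)
    unfold oscIntegrand
    fun_prop
  have key := integral_Ioi_of_hasDerivAt_of_tendsto hcont.continuousWithinAt hd hint
    (tendsto_zero_of_hasDerivAt_of_integrableOn_Ioi hd hint h3)
  have e := integral_add (h1.sub (h2.const_mul (c / 2))) (h3.const_mul (Complex.I * y))
  have e' := integral_sub h1 (h2.const_mul (c / 2))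
  simp only [Pi.sub_apply, integral_const_mul] at e e' key
  rw [e, e'] at key
  linear_combination key

lemma norm_mul_abs_oscIntegral_le {c : ℂ} (hc : 0 < c.re) {α : ℝ} (hα : 0 < α) (y : ℝ) :
    |y| * ‖oscIntegral c α y‖ ≤
      α * ‖oscIntegral c (α - 1) y‖ + ‖c‖ / 2 * ‖oscIntegral c (α - 1 / 2) y‖ := by
  have h := integral_Ioi_oscIntegrand_by_parts (c := c) (y := y) le_rfl (Or.inr hα.le)
    ((integrableOn_oscIntegrand hc (by linarith) y).const_mul _)
    (integrableOn_oscIntegrand hc (by linarith) y) (integrableOn_oscIntegrand hc (by linarith) y)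
  have h0 : oscIntegrand c α y 0 = 0 := by simp [oscIntegrand, Real.zero_rpow hα.ne']
  have h' := congrArg norm h
  rw [h0] at h'
  calc |y| * ‖oscIntegral c α y‖
      = ‖-(α * oscIntegral c (α - 1) y) + c / 2 * oscIntegral c (α - 1 / 2) y‖ := by
        simpa [oscIntegral] using h'
    _ ≤ _ := (norm_add_le _ _).trans_eq (by simp [abs_of_pos hα])

lemma norm_mul_abs_oscIntegral_zero_le {c : ℂ} (hc : 0 < c.re) (y : ℝ) :
    |y| * ‖oscIntegral c 0 y‖ ≤ 1 + ‖c‖ / 2 * ‖oscIntegral c (-1 / 2) y‖ := by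
  have h := integral_Ioi_oscIntegrand_by_parts (c := c) (y := y) (α := 0) le_rfl (Or.inr le_rfl)
    (by simp) (integrableOn_oscIntegrand hc (by norm_num) y)
    (integrableOn_oscIntegrand hc (by norm_num) y)
  have h0 : oscIntegrand c 0 y 0 = 1 := by simp [oscIntegrand]
  have h' := congrArg norm h
  rw [h0] at h'
  calc |y| * ‖oscIntegral c 0 y‖ = ‖-1 + c / 2 * oscIntegral c (-1 / 2) y‖ := by
        simpa [oscIntegral, neg_div] using h'
    _ ≤ _ := (norm_add_le _ _).trans_eq (by simp)

lemma norm_oscIntegrand_neg_one_le {c : ℂ} (hc : 0 < c.re) (y : ℝ) {ξ : ℝ} (hξ : 0 < ξ) :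
    ‖oscIntegrand c (-1) y ξ‖ ≤ c.re⁻¹ * ξ ^ (-3 / 2 : ℝ) := by
  rw [norm_oscIntegrand c _ y hξ.le]
  have hs := Real.sqrt_pos.2 hξ
  have e : ξ ^ (-1 : ℝ) = ξ ^ (-3 / 2 : ℝ) * Real.sqrt ξ := by
    rw [Real.sqrt_eq_rpow, ← Real.rpow_add hξ]
    norm_num
  have h1 : Real.sqrt ξ * Real.exp (-c.re * Real.sqrt ξ) ≤ c.re⁻¹ := by
    rw [neg_mul, Real.exp_neg, ← div_eq_mul_inv, div_le_iff₀ (Real.exp_pos _)]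
    have := Real.add_one_le_exp (c.re * Real.sqrt ξ)
    rw [inv_mul_eq_div, le_div_iff₀ hc]
    linarith
  rw [e, mul_assoc, mul_comm c.re⁻¹]
  exact mul_le_mul_of_nonneg_left h1 (Real.rpow_nonneg hξ.le _)

lemma integral_Ioi_rpow_neg_three_halves {a : ℝ} (ha : 0 < a) :
    ∫ ξ in Set.Ioi a, ξ ^ (-3 / 2 : ℝ) = 2 * a ^ (-1 / 2 : ℝ) := by
  rw [integral_Ioi_rpow_of_lt (by norm_num) ha]
  norm_num
  ring

lemma norm_integral_Ioi_oscIntegrand_neg_half_le {c : ℂ} (hc : 0 < c.re) (y : ℝ) {a : ℝ}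
    (ha : 0 < a) :
    |y| * ‖∫ ξ in Set.Ioi a, oscIntegrand c (-1 / 2) y ξ‖ ≤
      (2 + ‖c‖ / c.re) * a ^ (-1 / 2 : ℝ) := by
  have hi : IntegrableOn (fun ξ : ℝ => ξ ^ (-3 / 2 : ℝ)) (Set.Ioi a) :=
    integrableOn_Ioi_rpow_of_lt (by norm_num) ha
  have b1 : ∀ᵐ ξ ∂volume.restrict (Set.Ioi a),
      ‖oscIntegrand c (-3 / 2) y ξ‖ ≤ ξ ^ (-3 / 2 : ℝ) := by
    filter_upwards [ae_restrict_mem measurableSet_Ioi] with ξ hξ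
    exact norm_oscIntegrand_le hc _ y (ha.trans hξ).le
  have b2 : ∀ᵐ ξ ∂volume.restrict (Set.Ioi a),
      ‖oscIntegrand c (-1) y ξ‖ ≤ c.re⁻¹ * ξ ^ (-3 / 2 : ℝ) := by
    filter_upwards [ae_restrict_mem measurableSet_Ioi] with ξ hξ
    exact norm_oscIntegrand_neg_one_le hc y (ha.trans hξ)
  have i1 : IntegrableOn (oscIntegrand c (-3 / 2) y) (Set.Ioi a) :=
    Integrable.mono' hi (measurable_oscIntegrand _ _ _).aestronglyMeasurable b1
  have i2 : IntegrableOn (oscIntegrand c (-1) y) (Set.Ioi a) :=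
    Integrable.mono' (hi.const_mul _) (measurable_oscIntegrand _ _ _).aestronglyMeasurable b2
  have n1 := norm_integral_le_of_norm_le hi b1
  have n2 := norm_integral_le_of_norm_le (hi.const_mul _) b2
  rw [integral_const_mul] at n2
  rw [integral_Ioi_rpow_neg_three_halves ha] at n1 n2
  have e1 : (-1 / 2 : ℝ) - 1 = -3 / 2 := by norm_num
  have e2 : (-1 / 2 : ℝ) - 1 / 2 = -1 := by norm_num
  have h := integral_Ioi_oscIntegrand_by_parts (c := c) (y := y) (α := -1 / 2) ha.le (Or.inl ha)
    (by rw [e1]; exact i1.const_mul _) (by rw [e2]; exact i2)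
    ((integrableOn_oscIntegrand hc (by norm_num) y).mono_set (Set.Ioi_subset_Ioi ha.le))
  rw [e1, e2] at h
  have h' := congrArg norm h
  have n0 := norm_oscIntegrand_le hc (-1 / 2) y ha.le
  set A := oscIntegrand c (-1 / 2) y a
  set B := ∫ ξ in Set.Ioi a, oscIntegrand c (-3 / 2) y ξ
  set D := ∫ ξ in Set.Ioi a, oscIntegrand c (-1) y ξ
  calc |y| * ‖∫ ξ in Set.Ioi a, oscIntegrand c (-1 / 2) y ξ‖
      = ‖-A - ((-1 / 2 : ℝ) : ℂ) * B + c / 2 * D‖ := by rw [← h']; simp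
    _ ≤ ‖-A‖ + ‖((-1 / 2 : ℝ) : ℂ) * B‖ + ‖c / 2 * D‖ :=
        (norm_add_le _ _).trans (by gcongr; exact norm_sub_le _ _)
    _ = ‖A‖ + 1 / 2 * ‖B‖ + ‖c‖ / 2 * ‖D‖ := by
        rw [norm_neg, norm_mul, norm_mul, Complex.norm_real]
        norm_num
    _ ≤ a ^ (-1 / 2 : ℝ) + 1 / 2 * (2 * a ^ (-1 / 2 : ℝ))
          + ‖c‖ / 2 * (c.re⁻¹ * (2 * a ^ (-1 / 2 : ℝ))) := by gcongr
    _ = _ := by ring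

lemma norm_integral_Ioc_oscIntegrand_neg_half_le {c : ℂ} (hc : 0 < c.re) (y : ℝ) {a : ℝ}
    (ha : 0 < a) :
    ‖∫ ξ in Set.Ioc 0 a, oscIntegrand c (-1 / 2) y ξ‖ ≤ 2 * a ^ (1 / 2 : ℝ) := by
  have hi : IntegrableOn (fun ξ : ℝ => ξ ^ (-1 / 2 : ℝ)) (Set.Ioc 0 a) :=
    (intervalIntegrable_iff_integrableOn_Ioc_of_le ha.le).1
      (intervalIntegral.intervalIntegrable_rpow' (by norm_num))
  have b : ∀ᵐ ξ ∂volume.restrict (Set.Ioc 0 a),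
      ‖oscIntegrand c (-1 / 2) y ξ‖ ≤ ξ ^ (-1 / 2 : ℝ) := by
    filter_upwards [ae_restrict_mem measurableSet_Ioc] with ξ hξ
    exact norm_oscIntegrand_le hc _ y hξ.1.le
  refine (norm_integral_le_of_norm_le hi b).trans_eq ?_
  rw [← intervalIntegral.integral_of_le ha.le, integral_rpow (Or.inl (by norm_num))]
  norm_num
  ring

lemma norm_oscIntegral_neg_half_le {c : ℂ} (hc : 0 < c.re) {y : ℝ} (hy : 0 < |y|) :
    ‖oscIntegral c (-1 / 2) y‖ ≤ (4 + ‖c‖ / c.re) * |y| ^ (-1 / 2 : ℝ) := by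
  have ha : 0 < |y|⁻¹ := inv_pos.2 hy
  have hi := integrableOn_oscIntegrand hc (α := -1 / 2) (by norm_num) y
  have hsplit : oscIntegral c (-1 / 2) y = (∫ ξ in Set.Ioc 0 |y|⁻¹, oscIntegrand c (-1 / 2) y ξ)
      + ∫ ξ in Set.Ioi |y|⁻¹, oscIntegrand c (-1 / 2) y ξ := by
    rw [oscIntegral, ← Set.Ioc_union_Ioi_eq_Ioi ha.le]
    exact setIntegral_union (Set.Ioc_disjoint_Ioi le_rfl) measurableSet_Ioi
      (hi.mono_set Set.Ioc_subset_Ioi_self) (hi.mono_set (Set.Ioi_subset_Ioi ha.le))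
  have h1 := norm_integral_Ioc_oscIntegrand_neg_half_le hc y ha
  have h2 := norm_integral_Ioi_oscIntegrand_neg_half_le hc y ha
  have e1 : |y|⁻¹ ^ (1 / 2 : ℝ) = |y| ^ (-1 / 2 : ℝ) := by
    rw [Real.inv_rpow hy.le, ← Real.rpow_neg hy.le, neg_div]
  have e2 : |y|⁻¹ ^ (-1 / 2 : ℝ) = |y| * |y| ^ (-1 / 2 : ℝ) := by
    rw [Real.inv_rpow hy.le, ← Real.rpow_neg hy.le, ← Real.rpow_one_add' hy.le (by norm_num)]
    norm_num
  rw [e1] at h1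
  rw [e2, mul_left_comm] at h2
  have h2' := le_of_mul_le_mul_left h2 hy
  rw [hsplit]
  linarith [norm_add_le (∫ ξ in Set.Ioc 0 |y|⁻¹, oscIntegrand c (-1 / 2) y ξ)
    (∫ ξ in Set.Ioi |y|⁻¹, oscIntegrand c (-1 / 2) y ξ)]

/-- The bound `|∫₀^∞ ξ^α e^{−c√ξ + iyξ} dξ| ≤ C |y|^{−α−1}` for `|y| ≥ 1`. -/
def OscIntegralDecays (c : ℂ) (α : ℝ) : Prop :=
  ∃ C : ℝ, 0 ≤ C ∧ ∀ y : ℝ, 1 ≤ |y| → ‖oscIntegral c α y‖ ≤ C * |y| ^ (-α - 1)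

lemma oscIntegralDecays_neg_half {c : ℂ} (hc : 0 < c.re) : OscIntegralDecays c (-1 / 2) := by
  refine ⟨4 + ‖c‖ / c.re, by positivity, fun y hy => ?_⟩
  convert norm_oscIntegral_neg_half_le hc (zero_lt_one.trans_le hy) using 3
  norm_num

lemma oscIntegralDecays_zero {c : ℂ} (hc : 0 < c.re) : OscIntegralDecays c 0 := by
  obtain ⟨C, hC, h⟩ := oscIntegralDecays_neg_half hc
  refine ⟨1 + ‖c‖ / 2 * C, by positivity, fun y hy => ?_⟩
  have hy0 : 0 < |y| := zero_lt_one.trans_le hy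
  have e : |y| ^ (-0 - 1 : ℝ) = |y|⁻¹ := by
    rw [neg_zero, zero_sub, Real.rpow_neg_one]
  rw [e, ← div_eq_mul_inv, le_div_iff₀' hy0]
  refine (norm_mul_abs_oscIntegral_zero_le hc y).trans ?_
  gcongr
  refine (h y hy).trans (mul_le_of_le_one_right hC ?_)
  exact Real.rpow_le_one_of_one_le_of_nonpos hy (by norm_num)

lemma OscIntegralDecays.step {c : ℂ} (hc : 0 < c.re) {α : ℝ} (hα : 0 < α)
    (h1 : OscIntegralDecays c (α - 1)) (h2 : OscIntegralDecays c (α - 1 / 2)) :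
    OscIntegralDecays c α := by
  obtain ⟨C, hC, h1⟩ := h1
  obtain ⟨D, hD, h2⟩ := h2
  refine ⟨α * C + ‖c‖ / 2 * D, by positivity, fun y hy => ?_⟩
  have hy0 : 0 < |y| := zero_lt_one.trans_le hy
  have b1 : ‖oscIntegral c (α - 1) y‖ ≤ C * |y| ^ (-α) := by
    convert h1 y hy using 3
    ring
  have b2 : ‖oscIntegral c (α - 1 / 2) y‖ ≤ D * |y| ^ (-α) := by
    refine (h2 y hy).trans ?_
    gcongr
    linarith
  rw [Real.rpow_sub hy0, Real.rpow_one, ← mul_div_assoc, le_div_iff₀' hy0]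
  calc _ ≤ _ := norm_mul_abs_oscIntegral_le hc hα y
    _ ≤ α * (C * |y| ^ (-α)) + ‖c‖ / 2 * (D * |y| ^ (-α)) := by gcongr
    _ = _ := by ring

lemma oscIntegralDecays_three_halves {c : ℂ} (hc : 0 < c.re) :
    OscIntegralDecays c (3 / 2) := by
  have h1 : OscIntegralDecays c (1 / 2) := by
    refine .step hc (by norm_num) ?_ ?_
    · convert oscIntegralDecays_neg_half hc using 1; norm_num
    · convert oscIntegralDecays_zero hc using 1; norm_num
  have h2 : OscIntegralDecays c 1 := by
    refine .step hc (by norm_num) ?_ ?_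
    · convert oscIntegralDecays_zero hc using 1; norm_num
    · convert h1 using 1; norm_num
  refine .step hc (by norm_num) ?_ ?_
  · convert h1 using 1; norm_num
  · convert h2 using 1; norm_num

lemma exists_norm_oscIntegral_le {c : ℂ} (hc : 0 < c.re) {α : ℝ} (hα : -1 < α) :
    ∃ C : ℝ, 0 ≤ C ∧ ∀ y : ℝ, ‖oscIntegral c α y‖ ≤ C := by
  refine ⟨∫ ξ in Set.Ioi (0 : ℝ), ξ ^ α * Real.exp (-c.re * Real.sqrt ξ), ?_, fun y => ?_⟩
  · exact setIntegral_nonneg measurableSet_Ioi fun ξ hξ =>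
      mul_nonneg (Real.rpow_nonneg (le_of_lt hξ) _) (Real.exp_pos _).le
  · refine norm_integral_le_of_norm_le (integrableOn_rpow_mul_exp_neg_mul_sqrt hc hα) ?_
    filter_upwards [ae_restrict_mem measurableSet_Ioi] with ξ hξ
    exact (norm_oscIntegrand c α y (le_of_lt hξ)).le

lemma exists_norm_oscIntegral_three_halves_le {c : ℂ} (hc : 0 < c.re) :
    ∃ C : ℝ, 0 ≤ C ∧
      ∀ y : ℝ, ‖oscIntegral c (3 / 2) y‖ ≤ C * (1 + |y|) ^ (-(5 : ℝ) / 2) := by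
  obtain ⟨C, hC, h1⟩ := oscIntegralDecays_three_halves hc
  obtain ⟨D, hD, h2⟩ := exists_norm_oscIntegral_le hc (α := 3 / 2) (by norm_num)
  have htwo : (0 : ℝ) < 2 ^ (-(5 : ℝ) / 2) := by positivity
  refine ⟨(C + D) / 2 ^ (-(5 : ℝ) / 2), by positivity, fun y => ?_⟩
  rw [div_mul_eq_mul_div, le_div_iff₀ htwo]
  rcases le_total |y| 1 with hy | hy
  · have : (2 : ℝ) ^ (-(5 : ℝ) / 2) ≤ (1 + |y|) ^ (-(5 : ℝ) / 2) :=
      Real.rpow_le_rpow_of_nonpos (by positivity) (by linarith) (by norm_num)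
    exact mul_le_mul ((h2 y).trans (by linarith)) this htwo.le (by positivity)
  · have hy0 : 0 < |y| := zero_lt_one.trans_le hy
    have : (2 * |y|) ^ (-(5 : ℝ) / 2) ≤ (1 + |y|) ^ (-(5 : ℝ) / 2) :=
      Real.rpow_le_rpow_of_nonpos (by positivity) (by linarith) (by norm_num)
    rw [Real.mul_rpow (by norm_num) hy0.le] at this
    have b := h1 y hy
    have e : -(3 / 2 : ℝ) - 1 = -(5 : ℝ) / 2 := by norm_num
    rw [e] at b
    calc ‖oscIntegral c (3 / 2) y‖ * 2 ^ (-(5 : ℝ) / 2)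
        ≤ (C * |y| ^ (-(5 : ℝ) / 2)) * 2 ^ (-(5 : ℝ) / 2) := by gcongr
      _ = C * (2 ^ (-(5 : ℝ) / 2) * |y| ^ (-(5 : ℝ) / 2)) := by ring
      _ ≤ (C + D) * (1 + |y|) ^ (-(5 : ℝ) / 2) := by gcongr; linarith

lemma hasDerivAt_oscIntegral {c : ℂ} (hc : 0 < c.re) {α : ℝ} (hα : -1 < α) (y : ℝ) :
    HasDerivAt (oscIntegral c α) (Complex.I * oscIntegral c (α + 1) y) y := by
  have hb := integrableOn_rpow_mul_exp_neg_mul_sqrt hc (α := α + 1) (by linarith)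
  have h := hasDerivAt_integral_of_dominated_loc_of_deriv_le (𝕜 := ℝ)
    (μ := volume.restrict (Set.Ioi (0 : ℝ))) (F := oscIntegrand c α)
    (F' := fun y ξ => Complex.I * oscIntegrand c (α + 1) y ξ) (x₀ := y)
    Filter.univ_mem
    (Filter.Eventually.of_forall fun y => (measurable_oscIntegrand c α y).aestronglyMeasurable)
    (integrableOn_oscIntegrand hc hα y)
    ((measurable_oscIntegrand c _ y).const_mul _).aestronglyMeasurable ?_ hb ?_
  · have h2 := h.2
    rwa [integral_const_mul] at h2
  · filter_upwards [ae_restrict_mem measurableSet_Ioi] with ξ hξ y _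
    rw [norm_mul, Complex.norm_I, one_mul]
    exact (norm_oscIntegrand c _ y (le_of_lt hξ)).le
  · filter_upwards [ae_restrict_mem measurableSet_Ioi] with ξ hξ y _
    have h3 : HasDerivAt (fun x : ℝ => (x : ℂ)) 1 y := (hasDerivAt_id y).ofReal_comp
    have h4 := ((((h3.const_mul Complex.I).mul_const (ξ : ℂ)).const_add
      (-c * (Real.sqrt ξ : ℂ))).cexp).const_mul ((ξ ^ α : ℝ) : ℂ)
    refine h4.congr_deriv ?_
    rw [oscIntegrand, Real.rpow_add_one (ne_of_gt hξ)]
    push_cast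
    ring

lemma continuous_oscIntegral {c : ℂ} (hc : 0 < c.re) {α : ℝ} (hα : -1 < α) :
    Continuous (oscIntegral c α) :=
  continuous_iff_continuousAt.2 fun y => (hasDerivAt_oscIntegral hc hα y).continuousAt

/-- The value of `√(−2πi·s)` for `s = ±1`, as written in `sqrtSymbol`. -/
noncomputable def sqrtSymbolUnit (s : ℝ) : ℂ :=
  (Real.sqrt (2 * Real.pi) : ℂ) * Complex.exp (-(s : ℂ) * Complex.I * (Real.pi : ℂ) / 4)

lemma sqrtSymbolUnit_re_pos {s : ℝ} (hs : |s| = 1) : 0 < (sqrtSymbolUnit s).re := by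
  have e : -(s : ℂ) * Complex.I * (Real.pi : ℂ) / 4 = ((-s * Real.pi / 4 : ℝ) : ℂ) * Complex.I := by
    push_cast
    ring
  rw [sqrtSymbolUnit, e, Complex.re_ofReal_mul, Complex.exp_ofReal_mul_I_re]
  refine mul_pos (by positivity) (Real.cos_pos_of_mem_Ioo ⟨?_, ?_⟩) <;>
  rcases eq_or_eq_neg_of_abs_eq hs with rfl | rfl <;> linarith [Real.pi_pos]

lemma sqrtSymbol_mul {s ξ : ℝ} (hs : |s| = 1) (hξ : 0 < ξ) :
    sqrtSymbol (s * ξ) = sqrtSymbolUnit s * (Real.sqrt ξ : ℂ) := by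
  have e : Real.sign (s * ξ) = s := by
    rcases eq_or_eq_neg_of_abs_eq hs with rfl | rfl
    · rw [one_mul, Real.sign_of_pos hξ]
    · rw [neg_one_mul, Real.sign_of_neg (neg_neg_of_pos hξ)]
  rw [sqrtSymbol, e, abs_mul, hs, one_mul, abs_of_pos hξ, Real.sqrt_mul (by positivity),
    sqrtSymbolUnit]
  push_cast
  ring

lemma exp_mul_phiHat_mul {s ξ : ℝ} (hs : |s| = 1) (hξ : 0 < ξ) (x : ℝ) :
    Complex.exp (2 * (Real.pi : ℂ) * Complex.I * (x : ℂ) * ((s * ξ : ℝ) : ℂ)) * phiHat (s * ξ) =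
      -sqrtSymbolUnit s * oscIntegrand (sqrtSymbolUnit s) (1 / 2) (2 * Real.pi * s * x) ξ := by
  rw [phiHat, sqrtSymbol_mul hs hξ, oscIntegrand, Complex.exp_add, ← Real.sqrt_eq_rpow]
  have e : 2 * (Real.pi : ℂ) * Complex.I * (x : ℂ) * ((s * ξ : ℝ) : ℂ) =
      Complex.I * ((2 * Real.pi * s * x : ℝ) : ℂ) * ξ := by
    push_cast
    ring
  rw [e, neg_mul (sqrtSymbolUnit s) (Real.sqrt ξ : ℂ)]
  ring

lemma phi_eq_oscIntegral (x : ℝ) :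
    phi x = -sqrtSymbolUnit (-1) * oscIntegral (sqrtSymbolUnit (-1)) (1 / 2) (2 * Real.pi * -1 * x)
      + -sqrtSymbolUnit 1 * oscIntegral (sqrtSymbolUnit 1) (1 / 2) (2 * Real.pi * 1 * x) := by
  set f : ℝ → ℂ := fun ξ =>
    Complex.exp (2 * (Real.pi : ℂ) * Complex.I * (x : ℂ) * (ξ : ℂ)) * phiHat ξ
  have hs1 : |(1 : ℝ)| = 1 := by simp
  have hs2 : |(-1 : ℝ)| = 1 := by simp
  have e1 : Set.EqOn f (fun ξ => -sqrtSymbolUnit 1 *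
      oscIntegrand (sqrtSymbolUnit 1) (1 / 2) (2 * Real.pi * 1 * x) ξ) (Set.Ioi 0) := fun ξ hξ => by
    have := exp_mul_phiHat_mul hs1 hξ x
    rwa [one_mul] at this
  have e2 : Set.EqOn (fun ξ => f (-ξ)) (fun ξ => -sqrtSymbolUnit (-1) *
      oscIntegrand (sqrtSymbolUnit (-1)) (1 / 2) (2 * Real.pi * -1 * x) ξ) (Set.Ioi 0) := fun ξ hξ => by
    have := exp_mul_phiHat_mul hs2 hξ x
    rwa [neg_one_mul] at this
  have i1 : IntegrableOn f (Set.Ioi 0) :=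
    IntegrableOn.congr_fun
      ((integrableOn_oscIntegrand (sqrtSymbolUnit_re_pos hs1) (by norm_num) _).const_mul _)
      e1.symm measurableSet_Ioi
  have i2 : IntegrableOn (fun ξ => f (-ξ)) (Set.Ioi 0) :=
    IntegrableOn.congr_fun
      ((integrableOn_oscIntegrand (sqrtSymbolUnit_re_pos hs2) (by norm_num) _).const_mul _)
      e2.symm measurableSet_Ioi
  have i3 : IntegrableOn f (Set.Iic 0) := by
    rw [integrableOn_Iic_iff_integrableOn_Iio]
    simpa using i2.comp_neg
  have h := intervalIntegral.integral_Iic_add_Ioi i3 i1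
  have h2 := integral_comp_neg_Ioi 0 f
  rw [neg_zero] at h2
  rw [← h2, setIntegral_congr_fun measurableSet_Ioi e1,
    setIntegral_congr_fun measurableSet_Ioi e2, integral_const_mul, integral_const_mul] at h
  exact h.symm

lemma hasDerivAt_oscIntegral_comp_mul {c : ℂ} (hc : 0 < c.re) (k x : ℝ) :
    HasDerivAt (fun x => oscIntegral c (1 / 2) (k * x))
      (k * Complex.I * oscIntegral c (3 / 2) (k * x)) x := by
  have h := (hasDerivAt_oscIntegral hc (α := 1 / 2) (by norm_num) (k * x)).scomp x
    ((hasDerivAt_id x).const_mul k)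
  have e : (1 / 2 + 1 : ℝ) = 3 / 2 := by norm_num
  rw [e] at h
  refine h.congr_deriv ?_
  rw [Complex.real_smul]
  push_cast
  ring

lemma hasDerivAt_phi (x : ℝ) :
    HasDerivAt phi
      (-sqrtSymbolUnit (-1) * (((2 * Real.pi * -1 : ℝ) : ℂ) * Complex.I *
          oscIntegral (sqrtSymbolUnit (-1)) (3 / 2) (2 * Real.pi * -1 * x))
        + -sqrtSymbolUnit 1 * (((2 * Real.pi * 1 : ℝ) : ℂ) * Complex.I *
          oscIntegral (sqrtSymbolUnit 1) (3 / 2) (2 * Real.pi * 1 * x))) x := by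
  rw [funext phi_eq_oscIntegral]
  exact ((hasDerivAt_oscIntegral_comp_mul (sqrtSymbolUnit_re_pos (by simp)) _ x).const_mul _).add
    ((hasDerivAt_oscIntegral_comp_mul (sqrtSymbolUnit_re_pos (by simp)) _ x).const_mul _)

/-- `φ` is continuously differentiable and `|φ'(x)| ≤ C·(1+|x|)^{−5/2}` for all `x ∈ ℝ`. -/
theorem phi_deriv_decay :
    ContDiff ℝ 1 phi ∧
      ∃ C : ℝ, 0 < C ∧ ∀ x : ℝ, ‖deriv phi x‖ ≤ C * (1 + |x|) ^ (-(5 : ℝ) / 2) := by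
  have hc1 : 0 < (sqrtSymbolUnit 1).re := sqrtSymbolUnit_re_pos (by simp)
  have hc2 : 0 < (sqrtSymbolUnit (-1)).re := sqrtSymbolUnit_re_pos (by simp)
  have hd : deriv phi = _ := funext fun x => (hasDerivAt_phi x).deriv
  refine ⟨contDiff_one_iff_deriv.2 ⟨fun x => (hasDerivAt_phi x).differentiableAt, ?_⟩, ?_⟩
  · rw [hd]
    have h1 := continuous_oscIntegral hc1 (α := 3 / 2) (by norm_num)
    have h2 := continuous_oscIntegral hc2 (α := 3 / 2) (by norm_num)
    fun_prop
  · obtain ⟨C, hC, h1⟩ := exists_norm_oscIntegral_three_halves_le hc1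
    obtain ⟨D, hD, h2⟩ := exists_norm_oscIntegral_three_halves_le hc2
    set c := sqrtSymbolUnit 1
    set d := sqrtSymbolUnit (-1)
    refine ⟨‖d‖ * (2 * Real.pi * D) + ‖c‖ * (2 * Real.pi * C) + 1, by positivity, fun x => ?_⟩
    have hpi : 1 ≤ 2 * Real.pi := by linarith [Real.pi_gt_three]
    have hmono : ∀ s : ℝ, |s| = 1 →
        (1 + |2 * Real.pi * s * x|) ^ (-(5 : ℝ) / 2) ≤ (1 + |x|) ^ (-(5 : ℝ) / 2) := by
      intro s hs
      refine Real.rpow_le_rpow_of_nonpos (by positivity) ?_ (by norm_num)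
      rw [abs_mul, abs_mul, hs, mul_one, abs_of_pos Real.two_pi_pos]
      linarith [le_mul_of_one_le_left (abs_nonneg x) hpi]
    have hk : ∀ s : ℝ, |s| = 1 → ‖((2 * Real.pi * s : ℝ) : ℂ)‖ = 2 * Real.pi := by
      intro s hs
      rw [Complex.norm_real, Real.norm_eq_abs, abs_mul, hs, mul_one, abs_of_pos Real.two_pi_pos]
    have b1 := (h1 (2 * Real.pi * 1 * x)).trans
      (mul_le_mul_of_nonneg_left (hmono 1 (by simp)) hC)
    have b2 := (h2 (2 * Real.pi * -1 * x)).trans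
      (mul_le_mul_of_nonneg_left (hmono (-1) (by simp)) hD)
    have hP : 0 ≤ (1 + |x|) ^ (-(5 : ℝ) / 2) := by positivity
    rw [hd]
    refine (norm_add_le _ _).trans ?_
    simp only [norm_mul, norm_neg, Complex.norm_I, hk (-1) (by simp), hk 1 (by simp)]
    calc _ ≤ ‖d‖ * (2 * Real.pi * 1 * (D * (1 + |x|) ^ (-(5 : ℝ) / 2)))
          + ‖c‖ * (2 * Real.pi * 1 * (C * (1 + |x|) ^ (-(5 : ℝ) / 2))) := by gcongr
      _ ≤ _ := by linarith
end

section
/- There exists a constant C > 0 such that for every x ∈ ℝ with x ≠ 0, the function t ↦ φ_t(x) belongs to L²((0,∞), dt/t) and (∫_0^∞ |φ_t(x)|² dt/t)^{1/2} ≤ C/|x|. (This is the size condition of the Calderón–Zygmund kernel k(x,y) = {φ_t(x−y)}_{t>0} with values in the Hilbert space L²((0,∞), dt/t).) -/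
open MeasureTheory

open Set Filter Topology

/-- `r ↦ rⁿ e^{-wr}` is integrable on `(0, ∞)` when `Re w > 0`. -/
lemma integrableOn_pow_mul_cexp_neg_mul {w : ℂ} (hw : 0 < w.re) (n : ℕ) :
    IntegrableOn (fun r : ℝ => (r : ℂ) ^ n * Complex.exp (-w * r)) (Ioi 0) := by
  have h := integrableOn_rpow_mul_exp_neg_mul_rpow (p := 1) (s := n) (b := w.re)
    (by have : (0 : ℝ) ≤ n := n.cast_nonneg
        linarith) one_pos hw
  refine Integrable.mono' h (Continuous.aestronglyMeasurable (by fun_prop)) ?_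
  filter_upwards [ae_restrict_mem measurableSet_Ioi] with r hr
  have hr : 0 < r := hr
  simp [Complex.norm_exp, abs_of_pos hr]

lemma tendsto_pow_mul_cexp_neg_mul {w : ℂ} (hw : 0 < w.re) (n : ℕ) :
    Tendsto (fun r : ℝ => (r : ℂ) ^ n * Complex.exp (-w * r)) atTop (𝓝 0) := by
  rw [tendsto_zero_iff_norm_tendsto_zero]
  refine (tendsto_rpow_mul_exp_neg_mul_atTop_nhds_zero n w.re hw).congr' ?_
  filter_upwards [eventually_gt_atTop 0] with r hr
  simp [Complex.norm_exp, abs_of_pos hr]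

lemma norm_cexp_I_mul_sq (y r : ℝ) : ‖Complex.exp (Complex.I * y * (r : ℂ) ^ 2)‖ = 1 := by
  have : Complex.I * y * (r : ℂ) ^ 2 = ((y * r ^ 2 : ℝ) : ℂ) * Complex.I := by
    push_cast; ring
  rw [this, Complex.norm_exp_ofReal_mul_I]

lemma MeasureTheory.IntegrableOn.mul_cexp_I_mul_sq {f : ℝ → ℂ} {s : Set ℝ} (hf : IntegrableOn f s) (y : ℝ) :
    IntegrableOn (fun r : ℝ => f r * Complex.exp (Complex.I * y * (r : ℂ) ^ 2)) s :=
  Integrable.mul_bdd hf (Continuous.aestronglyMeasurable (by fun_prop))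
    (c := 1)
    (ae_of_all _ fun r => (norm_cexp_I_mul_sq y r).le)

lemma Filter.Tendsto.mul_cexp_I_mul_sq {f : ℝ → ℂ} (hf : Tendsto f atTop (𝓝 0)) (y : ℝ) :
    Tendsto (fun r : ℝ => f r * Complex.exp (Complex.I * y * (r : ℂ) ^ 2)) atTop (𝓝 0) := by
  rw [tendsto_zero_iff_norm_tendsto_zero] at hf ⊢
  simpa [norm_cexp_I_mul_sq] using hf

lemma hasDerivAt_complexOfReal (r : ℝ) : HasDerivAt (fun r : ℝ => (r : ℂ)) 1 r :=
  Complex.ofRealCLM.hasDerivAt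

lemma hasDerivAt_cexp_I_mul_sq (y r : ℝ) :
    HasDerivAt (fun r : ℝ => Complex.exp (Complex.I * y * (r : ℂ) ^ 2))
      (2 * Complex.I * y * r * Complex.exp (Complex.I * y * (r : ℂ) ^ 2)) r := by
  have h := (((hasDerivAt_complexOfReal r).fun_pow 2).const_mul (Complex.I * y)).cexp
  refine h.congr_deriv ?_
  simp
  ring

lemma hasDerivAt_cexp_neg_mul (w : ℂ) (r : ℝ) :
    HasDerivAt (fun r : ℝ => Complex.exp (-w * r)) (-w * Complex.exp (-w * r)) r := by
  have h := ((hasDerivAt_complexOfReal r).const_mul (-w)).cexp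
  refine h.congr_deriv ?_
  simp
  ring

/-- Integration by parts against `r e^{-wr} d(e^{iyr²})`. -/
lemma integral_sq_mul_cexp_neg_mul {w : ℂ} (hw : 0 < w.re) (y : ℝ) :
    2 * Complex.I * y * ∫ r in Ioi (0 : ℝ), (r : ℂ) ^ 2 * Complex.exp (-w * r) *
        Complex.exp (Complex.I * y * (r : ℂ) ^ 2) =
      -∫ r in Ioi (0 : ℝ), (1 - w * r) * Complex.exp (-w * r) *
        Complex.exp (Complex.I * y * (r : ℂ) ^ 2) := by
  have i0 := integrableOn_pow_mul_cexp_neg_mul hw 0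
  have i1 := integrableOn_pow_mul_cexp_neg_mul hw 1
  have iA : IntegrableOn (fun r : ℝ => (1 - w * r) * Complex.exp (-w * r) *
        Complex.exp (Complex.I * y * (r : ℂ) ^ 2)) (Ioi 0) := by
    refine IntegrableOn.mul_cexp_I_mul_sq ((i0.sub (i1.const_mul w)).congr ?_) y
    exact ae_of_all _ fun r => by simp; ring
  have iB := ((integrableOn_pow_mul_cexp_neg_mul hw 2).mul_cexp_I_mul_sq y).const_mul
    (2 * Complex.I * y)
  have key := integral_Ioi_of_hasDerivAt_of_tendsto' (a := 0)
    (f := fun r : ℝ => ((r : ℂ) ^ 1 * Complex.exp (-w * r)) *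
      Complex.exp (Complex.I * y * (r : ℂ) ^ 2))
    (fun r _ => by
      have h := (((hasDerivAt_complexOfReal r).fun_pow 1).fun_mul (hasDerivAt_cexp_neg_mul w r)).fun_mul
        (hasDerivAt_cexp_I_mul_sq y r)
      refine h.congr_deriv ?_
      simp
      ring) (iA.add iB) ((tendsto_pow_mul_cexp_neg_mul hw 1).mul_cexp_I_mul_sq y)
  rw [← integral_const_mul, eq_neg_iff_add_eq_zero, add_comm, ← integral_add iA iB]
  simpa using key

lemma norm_one_sub_mul_mul_cexp_le {w : ℂ} (hw : 0 < w.re) {r : ℝ} (hr : 0 ≤ r) :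
    ‖(1 - w * r) * Complex.exp (-w * r)‖ ≤ 1 + ‖w‖ / w.re := by
  have h1 : ‖1 - w * r‖ ≤ 1 + ‖w‖ * r := by
    refine (norm_sub_le _ _).trans ?_
    simp [abs_of_nonneg hr]
  have h2 : ‖Complex.exp (-w * r)‖ = Real.exp (-(w.re * r)) := by simp [Complex.norm_exp]
  have h3 : Real.exp (-(w.re * r)) ≤ 1 := by
    rw [Real.exp_le_one_iff]; nlinarith
  have h4 : r * Real.exp (-(w.re * r)) ≤ 1 / w.re := by
    rw [Real.exp_neg, ← div_eq_mul_inv, div_le_div_iff₀ (Real.exp_pos _) hw]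
    linarith [Real.add_one_le_exp (w.re * r)]
  rw [norm_mul, h2]
  calc _ ≤ (1 + ‖w‖ * r) * Real.exp (-(w.re * r)) := by gcongr
    _ = Real.exp (-(w.re * r)) + ‖w‖ * (r * Real.exp (-(w.re * r))) := by ring
    _ ≤ 1 + ‖w‖ * (1 / w.re) := by gcongr
    _ = _ := by ring

lemma integrableOn_one_sub_mul_mul_cexp {w : ℂ} (hw : 0 < w.re) :
    IntegrableOn (fun r : ℝ => (1 - w * r) * Complex.exp (-w * r)) (Ioi 0) :=
  ((integrableOn_pow_mul_cexp_neg_mul hw 0).sub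
    ((integrableOn_pow_mul_cexp_neg_mul hw 1).const_mul w)).congr
      (ae_of_all _ fun r => by simp; ring)

lemma hasDerivAt_one_sub_mul_mul_cexp (w : ℂ) (r : ℝ) :
    HasDerivAt (fun r : ℝ => (1 - w * r) * Complex.exp (-w * r))
      ((w ^ 2 * r - 2 * w) * Complex.exp (-w * r)) r := by
  have h := (((hasDerivAt_complexOfReal r).const_mul w).const_sub 1).fun_mul
    (hasDerivAt_cexp_neg_mul w r)
  refine h.congr_deriv ?_
  ring

lemma integrableOn_deriv_one_sub_mul_mul_cexp {w : ℂ} (hw : 0 < w.re) :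
    IntegrableOn (fun r : ℝ => (w ^ 2 * r - 2 * w) * Complex.exp (-w * r)) (Ioi 0) :=
  (((integrableOn_pow_mul_cexp_neg_mul hw 1).const_mul (w ^ 2)).sub
    ((integrableOn_pow_mul_cexp_neg_mul hw 0).const_mul (2 * w))).congr
      (ae_of_all _ fun r => by simp; ring)

lemma tendsto_one_sub_mul_mul_cexp {w : ℂ} (hw : 0 < w.re) :
    Tendsto (fun r : ℝ => (1 - w * r) * Complex.exp (-w * r)) atTop (𝓝 0) := by
  have h := (tendsto_pow_mul_cexp_neg_mul hw 0).sub
    ((tendsto_pow_mul_cexp_neg_mul hw 1).const_mul w)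
  simp only [mul_zero, sub_zero] at h
  exact h.congr fun r => by ring

lemma integrableOn_inv_one_add_mul_sq {k : ℝ} (hk : 0 < k) :
    IntegrableOn (fun r : ℝ => (1 + (k * r) ^ 2)⁻¹) (Ioi 0) :=
  (integrable_inv_one_add_sq.comp_mul_left' hk.ne').integrableOn

lemma integral_inv_one_add_mul_sq {k : ℝ} (hk : 0 < k) :
    ∫ r in Ioi (0 : ℝ), (1 + (k * r) ^ 2)⁻¹ = Real.pi / 2 / k := by
  rw [integral_comp_mul_left_Ioi (fun r : ℝ => (1 + r ^ 2)⁻¹) 0 hk]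
  simp [integral_Ioi_inv_one_add_sq]
  ring

lemma hasDerivAt_div_one_add_mul_sq (k r : ℝ) :
    HasDerivAt (fun r : ℝ => r / (1 + (k * r) ^ 2))
      ((1 - (k * r) ^ 2) / (1 + (k * r) ^ 2) ^ 2) r := by
  have h0 : 1 + (k * r) ^ 2 ≠ 0 := by positivity
  have h := (hasDerivAt_id' r).fun_div
    ((((hasDerivAt_id' r).const_mul k).fun_pow 2).const_add 1) h0
  refine h.congr_deriv ?_
  simp
  ring

lemma abs_div_one_add_mul_sq_le {k : ℝ} (hk : 0 < k) (r : ℝ) :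
    |r / (1 + (k * r) ^ 2)| ≤ 1 / (2 * k) := by
  have h0 : 0 < 1 + (k * r) ^ 2 := by positivity
  rw [abs_div, abs_of_pos h0, div_le_div_iff₀ h0 (by positivity)]
  have : (k * r) ^ 2 = (k * |r|) ^ 2 := by rw [mul_pow, mul_pow, sq_abs]
  rw [this]
  nlinarith [sq_nonneg (k * |r| - 1)]

lemma abs_deriv_div_one_add_mul_sq_le (k r : ℝ) :
    |(1 - (k * r) ^ 2) / (1 + (k * r) ^ 2) ^ 2| ≤ (1 + (k * r) ^ 2)⁻¹ := by
  have h0 : 0 < 1 + (k * r) ^ 2 := by positivity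
  have h1 : |1 - (k * r) ^ 2| ≤ 1 + (k * r) ^ 2 := by
    rw [abs_le]; constructor <;> nlinarith [sq_nonneg (k * r)]
  rw [abs_div, abs_of_pos (pow_pos h0 2), div_le_iff₀ (pow_pos h0 2)]
  refine h1.trans (le_of_eq ?_)
  field_simp

/-- Van der Corput type bound for the phase `y r²`, obtained by integrating by parts against the
multiplier `r / (1 + |y| r²)`. -/
lemma exists_norm_integral_one_sub_mul_mul_cexp_le {w : ℂ} (hw : 0 < w.re) :
    ∃ C : ℝ, 0 ≤ C ∧ ∀ y : ℝ, y ≠ 0 →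
      ‖∫ r in Ioi (0 : ℝ), (1 - w * r) * Complex.exp (-w * r) *
        Complex.exp (Complex.I * y * (r : ℂ) ^ 2)‖ ≤ C / Real.sqrt |y| := by
  set H : ℝ := 1 + ‖w‖ / w.re with hH
  have H0 : 0 ≤ H := by positivity
  set D : ℝ := ∫ r in Ioi (0 : ℝ), ‖(w ^ 2 * r - 2 * w) * Complex.exp (-w * r)‖ with hD
  have D0 : 0 ≤ D := integral_nonneg fun _ => norm_nonneg _
  refine ⟨(3 * H * (Real.pi / 2) + D / 2) / 2, by positivity, fun y hy => ?_⟩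
  set k := Real.sqrt |y| with hk
  have k0 : 0 < k := Real.sqrt_pos.2 (abs_pos.2 hy)
  obtain ⟨s, hs, hys⟩ : ∃ s : ℝ, |s| = 1 ∧ y = s * k ^ 2 := by
    refine ⟨SignType.sign y, ?_, ?_⟩
    · rcases lt_or_gt_of_ne hy with h | h <;> simp [h]
    · rw [hk, Real.sq_sqrt (abs_nonneg y), sign_mul_abs]
  set b : ℝ → ℝ := fun r => r / (1 + (k * r) ^ 2) with hb
  set b' : ℝ → ℝ := fun r => (1 - (k * r) ^ 2) / (1 + (k * r) ^ 2) ^ 2 with hb'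
  set q : ℝ → ℝ := fun r => (1 + (k * r) ^ 2)⁻¹ with hq
  set h : ℝ → ℂ := fun r => (1 - w * r) * Complex.exp (-w * r) with hh
  set h' : ℝ → ℂ := fun r => (w ^ 2 * r - 2 * w) * Complex.exp (-w * r) with hh'
  set e : ℝ → ℂ := fun r => Complex.exp (Complex.I * y * (r : ℂ) ^ 2) with he
  set G : ℝ → ℂ := fun r => b' r * h r + b r * h' r - 2 * Complex.I * s * q r * h r with hG
  have iq : IntegrableOn q (Ioi 0) := integrableOn_inv_one_add_mul_sq k0
  have ih : IntegrableOn h (Ioi 0) := integrableOn_one_sub_mul_mul_cexp hw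
  have ih' : IntegrableOn h' (Ioi 0) := integrableOn_deriv_one_sub_mul_mul_cexp hw
  have q0 (r : ℝ) : 0 < q r := by simp only [hq]; positivity
  have cq (r : ℝ) : (1 + (k * r) ^ 2) ≠ 0 := by positivity
  have G_le (r : ℝ) (hr : r ∈ Ioi (0 : ℝ)) :
      ‖G r‖ ≤ 3 * H * q r + 1 / (2 * k) * ‖h' r‖ := by
    have e1 : ‖h r‖ ≤ H := norm_one_sub_mul_mul_cexp_le hw (le_of_lt hr)
    have e2 : |b r| ≤ 1 / (2 * k) := abs_div_one_add_mul_sq_le k0 r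
    have e3 : |b' r| ≤ q r := abs_deriv_div_one_add_mul_sq_le k r
    have n1 : ‖(b' r : ℂ) * h r‖ = |b' r| * ‖h r‖ := by simp
    have n2 : ‖(b r : ℂ) * h' r‖ = |b r| * ‖h' r‖ := by simp
    have n3 : ‖2 * Complex.I * s * q r * h r‖ = 2 * q r * ‖h r‖ := by
      simp [hs, abs_of_pos (q0 r)]
    calc ‖G r‖ ≤ ‖(b' r : ℂ) * h r‖ + ‖(b r : ℂ) * h' r‖ + ‖2 * Complex.I * s * q r * h r‖ :=
          (norm_sub_le _ _).trans (by gcongr; exact norm_add_le _ _)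
      _ = |b' r| * ‖h r‖ + |b r| * ‖h' r‖ + 2 * q r * ‖h r‖ := by rw [n1, n2, n3]
      _ ≤ q r * H + 1 / (2 * k) * ‖h' r‖ + 2 * q r * H := by
          have := q0 r
          gcongr
      _ = _ := by ring
  have ibound : IntegrableOn (fun r => 3 * H * q r + 1 / (2 * k) * ‖h' r‖) (Ioi 0) :=
    (iq.const_mul _).add (ih'.norm.const_mul _)
  have G_cont : Continuous G := by
    have cb : Continuous b := by fun_prop (disch := exact cq)
    have cb' : Continuous b' := by fun_prop (disch := exact fun r => pow_ne_zero 2 (cq r))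
    have cq' : Continuous q := by fun_prop (disch := exact cq)
    fun_prop
  have iG : IntegrableOn G (Ioi 0) :=
    Integrable.mono' ibound G_cont.aestronglyMeasurable
      ((ae_restrict_mem measurableSet_Ioi).mono G_le)
  have iGe : IntegrableOn (fun r => G r * e r) (Ioi 0) := iG.mul_cexp_I_mul_sq y
  have ihe : IntegrableOn (fun r => 2 * Complex.I * s * (h r * e r)) (Ioi 0) :=
    (ih.mul_cexp_I_mul_sq y).const_mul _
  have hlim : Tendsto (fun r : ℝ => (b r : ℂ) * h r * e r) atTop (𝓝 0) := by
    refine Tendsto.mul_cexp_I_mul_sq ?_ y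
    have h1 := tendsto_one_sub_mul_mul_cexp hw
    refine squeeze_zero_norm (a := fun r => 1 / (2 * k) * ‖h r‖) (fun r => ?_) ?_
    · rw [norm_mul, Complex.norm_real]
      gcongr
      exact abs_div_one_add_mul_sq_le k0 r
    · simpa only [norm_zero, mul_zero] using h1.norm.const_mul (1 / (2 * k))
  have key := integral_Ioi_of_hasDerivAt_of_tendsto' (a := 0)
    (f := fun r : ℝ => (b r : ℂ) * h r * e r)
    (f' := fun r => G r * e r + 2 * Complex.I * s * (h r * e r))
    (fun r _ => by
      have hd := ((hasDerivAt_div_one_add_mul_sq k r).ofReal_comp.fun_mul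
        (hasDerivAt_one_sub_mul_mul_cexp w r)).fun_mul (hasDerivAt_cexp_I_mul_sq y r)
      refine hd.congr_deriv (Eq.symm ?_)
      have hqb : (y : ℂ) * r * b r = s - s * q r := by
        have : y * r * b r = s - s * q r := by
          have := cq r
          simp only [hb, hq, hys]
          field_simp
          ring
        exact_mod_cast this
      change G r * e r + 2 * Complex.I * s * (h r * e r) =
        (b' r * h r + b r * h' r) * e r + b r * h r * (2 * Complex.I * y * r * e r)
      simp only [hG]
      linear_combination (-2 * Complex.I * h r * e r) * hqb) (iGe.add ihe) hlim
  rw [integral_add iGe ihe, integral_const_mul] at key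
  have hb0 : b 0 = 0 := by simp [hb]
  simp only [hb0, Complex.ofReal_zero, zero_mul, sub_zero] at key
  have hnorm : 2 * ‖∫ r in Ioi (0 : ℝ), h r * e r‖ = ‖∫ r in Ioi (0 : ℝ), G r * e r‖ := by
    rw [eq_neg_of_add_eq_zero_left key]
    simp [hs]
  have hle : ‖∫ r in Ioi (0 : ℝ), G r * e r‖ ≤
      ∫ r in Ioi (0 : ℝ), (3 * H * q r + 1 / (2 * k) * ‖h' r‖) := by
    refine norm_integral_le_of_norm_le ibound ((ae_restrict_mem measurableSet_Ioi).mono ?_)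
    intro r hr
    rw [norm_mul, norm_cexp_I_mul_sq, mul_one]
    exact G_le r hr
  rw [integral_add (iq.const_mul _) (ih'.norm.const_mul _), integral_const_mul,
    integral_const_mul, integral_inv_one_add_mul_sq k0, ← hD] at hle
  have : ‖∫ r in Ioi (0 : ℝ), h r * e r‖ ≤
      (3 * H * (Real.pi / 2 / k) + 1 / (2 * k) * D) / 2 := by linarith
  refine this.trans (le_of_eq ?_)
  field_simp

lemma exists_norm_integral_sq_mul_cexp_le {w : ℂ} (hw : 0 < w.re) :
    ∃ C : ℝ, 0 ≤ C ∧ ∀ y : ℝ, y ≠ 0 →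
      ‖∫ r in Ioi (0 : ℝ), (r : ℂ) ^ 2 * Complex.exp (-w * r) *
        Complex.exp (Complex.I * y * (r : ℂ) ^ 2)‖ ≤ C / (|y| * Real.sqrt |y|) := by
  obtain ⟨C, hC, h⟩ := exists_norm_integral_one_sub_mul_mul_cexp_le hw
  refine ⟨C / 2, by positivity, fun y hy => ?_⟩
  have key := congrArg norm (integral_sq_mul_cexp_neg_mul hw y)
  have hy' := abs_pos.2 hy
  have hs := Real.sqrt_pos.2 hy'
  rw [norm_neg, norm_mul] at key
  have h2 : ‖2 * Complex.I * (y : ℂ)‖ = 2 * |y| := by simp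
  have h3 := h y hy
  rw [← key, h2, le_div_iff₀ hs] at h3
  rw [le_div_iff₀ (by positivity)]
  linarith

/-- The slope `√(2π) e^{-iεπ/4}` of `r ↦ sqrtSymbol (ε r²)`, for `ε = ±1`. -/
noncomputable def sqrtSlope (ε : ℝ) : ℂ :=
  (Real.sqrt (2 * Real.pi) : ℂ) * Complex.exp (-(ε : ℂ) * Complex.I * (Real.pi : ℂ) / 4)

lemma sqrtSlope_re_pos {ε : ℝ} (hε : |ε| = 1) : 0 < (sqrtSlope ε).re := by
  have h : -(ε : ℂ) * Complex.I * (Real.pi : ℂ) / 4 =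
      ((-(ε * (Real.pi / 4)) : ℝ) : ℂ) * Complex.I := by
    push_cast; ring
  rw [sqrtSlope, h, Complex.re_ofReal_mul, Complex.exp_ofReal_mul_I_re, Real.cos_neg,
    ← Real.cos_abs, abs_mul, hε, one_mul, abs_of_pos (by positivity), Real.cos_pi_div_four]
  positivity

lemma sqrtSymbol_mul_sq {ε r : ℝ} (hε : |ε| = 1) (hr : 0 < r) :
    sqrtSymbol (ε * r ^ 2) = sqrtSlope ε * r := by
  have h1 : Real.sqrt (2 * Real.pi * |ε * r ^ 2|) = Real.sqrt (2 * Real.pi) * r := by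
    rw [abs_mul, hε, one_mul, abs_of_pos (by positivity), Real.sqrt_mul (by positivity),
      Real.sqrt_sq hr.le]
  have h2 : Real.sign (ε * r ^ 2) = ε := by
    rcases (abs_eq one_pos.le).1 hε with rfl | rfl
    · exact Real.sign_of_pos (by positivity)
    · exact Real.sign_of_neg (by nlinarith [pow_pos hr 2])
  rw [sqrtSymbol, sqrtSlope, h1, h2]
  push_cast
  ring

lemma jacobian_smul_phiHat {ε r : ℝ} (hε : |ε| = 1) (hr : 0 < r) :
    (|(2 : ℝ)| * r ^ ((2 : ℝ) - 1)) • phiHat (ε * r ^ (2 : ℝ)) =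
      -2 * sqrtSlope ε * ((r : ℂ) ^ 2 * Complex.exp (-sqrtSlope ε * r)) := by
  rw [Real.rpow_two, phiHat, sqrtSymbol_mul_sq hε hr, Complex.real_smul, neg_mul (sqrtSlope ε)]
  norm_num
  ring

lemma integrableOn_phiHat_mul {ε : ℝ} (hε : |ε| = 1) :
    IntegrableOn (fun ξ : ℝ => phiHat (ε * ξ)) (Ioi 0) := by
  rw [← integrableOn_Ioi_comp_rpow_iff _ two_ne_zero]
  refine IntegrableOn.congr_fun ((integrableOn_pow_mul_cexp_neg_mul (sqrtSlope_re_pos hε) 2).const_mul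
    (-2 * sqrtSlope ε)) (fun r hr => ?_) measurableSet_Ioi
  exact (jacobian_smul_phiHat hε hr).symm

lemma integrable_phiHat : Integrable phiHat := by
  rw [← integrableOn_univ, ← Iio_union_Ici (a := (0 : ℝ)), integrableOn_union,
    integrableOn_Ici_iff_integrableOn_Ioi]
  constructor
  · rw [← (Measure.measurePreserving_neg (volume : Measure ℝ)).integrableOn_comp_preimage
      (Homeomorph.neg ℝ).measurableEmbedding]
    simpa [Function.comp_def] using integrableOn_phiHat_mul (ε := -1) (by simp)
  · simpa using integrableOn_phiHat_mul (ε := 1) (by simp)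

lemma setIntegral_Ioi_cexp_mul_phiHat {ε : ℝ} (hε : |ε| = 1) (x : ℝ) :
    ∫ ξ in Ioi (0 : ℝ), Complex.exp (2 * (Real.pi : ℂ) * Complex.I * (x : ℂ) * ((ε * ξ : ℝ) : ℂ)) *
        phiHat (ε * ξ) =
      -2 * sqrtSlope ε * ∫ r in Ioi (0 : ℝ), (r : ℂ) ^ 2 * Complex.exp (-sqrtSlope ε * r) *
        Complex.exp (Complex.I * (2 * Real.pi * x * ε : ℝ) * (r : ℂ) ^ 2) := by
  rw [← integral_comp_rpow_Ioi _ two_ne_zero, ← integral_const_mul]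
  refine setIntegral_congr_fun measurableSet_Ioi fun r hr => ?_
  have h := jacobian_smul_phiHat hε hr
  rw [← mul_smul_comm, h, Real.rpow_two]
  have : 2 * (Real.pi : ℂ) * Complex.I * (x : ℂ) * ((ε * r ^ 2 : ℝ) : ℂ) =
      Complex.I * (2 * Real.pi * x * ε : ℝ) * (r : ℂ) ^ 2 := by
    push_cast; ring
  rw [this]
  ring

lemma norm_cexp_two_pi_I_mul (x ξ : ℝ) :
    ‖Complex.exp (2 * (Real.pi : ℂ) * Complex.I * (x : ℂ) * (ξ : ℂ))‖ = 1 := by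
  have : 2 * (Real.pi : ℂ) * Complex.I * (x : ℂ) * (ξ : ℂ) =
      ((2 * Real.pi * x * ξ : ℝ) : ℂ) * Complex.I := by
    push_cast; ring
  rw [this, Complex.norm_exp_ofReal_mul_I]

lemma integrable_cexp_mul_phiHat (x : ℝ) :
    Integrable fun ξ : ℝ =>
      Complex.exp (2 * (Real.pi : ℂ) * Complex.I * (x : ℂ) * (ξ : ℂ)) * phiHat ξ :=
  integrable_phiHat.bdd_mul (c := 1) (Continuous.aestronglyMeasurable (by fun_prop))
    (ae_of_all _ fun ξ => (norm_cexp_two_pi_I_mul x ξ).le)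

lemma continuous_phi : Continuous phi := by
  refine continuous_of_dominated (bound := fun ξ => ‖phiHat ξ‖)
    (fun x => (integrable_cexp_mul_phiHat x).aestronglyMeasurable)
    (fun x => ae_of_all _ fun ξ => ?_) integrable_phiHat.norm (ae_of_all _ fun ξ => by fun_prop)
  rw [norm_mul, norm_cexp_two_pi_I_mul, one_mul]

lemma norm_phi_le_s4 (x : ℝ) : ‖phi x‖ ≤ ∫ ξ, ‖phiHat ξ‖ := by
  refine norm_integral_le_of_norm_le integrable_phiHat.norm (ae_of_all _ fun ξ => ?_)
  rw [norm_mul, norm_cexp_two_pi_I_mul, one_mul]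

lemma phi_eq_add (x : ℝ) :
    phi x =
      (∫ ξ in Ioi (0 : ℝ), Complex.exp (2 * (Real.pi : ℂ) * Complex.I * (x : ℂ) *
        ((-1 * ξ : ℝ) : ℂ)) * phiHat (-1 * ξ)) +
      ∫ ξ in Ioi (0 : ℝ), Complex.exp (2 * (Real.pi : ℂ) * Complex.I * (x : ℂ) *
        ((1 * ξ : ℝ) : ℂ)) * phiHat (1 * ξ) := by
  have hi := integrable_cexp_mul_phiHat x
  rw [phi, ← integral_add_compl measurableSet_Iic hi, compl_Iic (a := (0 : ℝ))]
  congr 1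
  · have := integral_comp_neg_Ioi 0 fun ξ : ℝ =>
      Complex.exp (2 * (Real.pi : ℂ) * Complex.I * (x : ℂ) * (ξ : ℂ)) * phiHat ξ
    rw [neg_zero] at this
    simp only [← this, neg_one_mul]
  · simp only [one_mul]

/-- Decay `|φ(x)| ≲ |x|^{-3/2}`. -/
lemma exists_norm_phi_le :
    ∃ C : ℝ, 0 ≤ C ∧ ∀ x : ℝ, x ≠ 0 → ‖phi x‖ ≤ C / (|x| * Real.sqrt |x|) := by
  have half : ∀ ε : ℝ, |ε| = 1 → ∃ C : ℝ, 0 ≤ C ∧ ∀ x : ℝ, x ≠ 0 →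
      ‖∫ ξ in Ioi (0 : ℝ), Complex.exp (2 * (Real.pi : ℂ) * Complex.I * (x : ℂ) *
        ((ε * ξ : ℝ) : ℂ)) * phiHat (ε * ξ)‖ ≤ C / (|x| * Real.sqrt |x|) := by
    intro ε hε
    obtain ⟨C, hC, h⟩ := exists_norm_integral_sq_mul_cexp_le (sqrtSlope_re_pos hε)
    refine ⟨2 * ‖sqrtSlope ε‖ * C, by positivity, fun x hx => ?_⟩
    have hε0 : ε ≠ 0 := by
      rintro rfl
      simp at hε
    have hx' := abs_pos.2 hx
    have hy : |x| ≤ |2 * Real.pi * x * ε| := by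
      rw [abs_mul, hε, mul_one, abs_mul, abs_of_pos (a := 2 * Real.pi) (by positivity)]
      nlinarith [Real.pi_gt_three]
    rw [setIntegral_Ioi_cexp_mul_phiHat hε, norm_mul]
    have h2 : ‖-2 * sqrtSlope ε‖ = 2 * ‖sqrtSlope ε‖ := by simp
    rw [h2, mul_div_assoc]
    gcongr
    refine (h (2 * Real.pi * x * ε) (by positivity)).trans ?_
    gcongr
  obtain ⟨C₁, h₁, H₁⟩ := half (-1) (by simp)
  obtain ⟨C₂, h₂, H₂⟩ := half 1 (by simp)
  refine ⟨C₁ + C₂, by positivity, fun x hx => ?_⟩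
  rw [phi_eq_add, add_div]
  exact (norm_add_le _ _).trans (add_le_add (H₁ x hx) (H₂ x hx))

/-- Size condition of the kernel `k(x,y) = {φ_t(x−y)}_{t>0}` with values in
`L²((0,∞), dt/t)`: for `x ≠ 0`, `t ↦ φ_t(x)` is in `L²((0,∞), dt/t)` and
`(∫_0^∞ |φ_t(x)|² dt/t)^{1/2} ≤ C/|x|`. -/
theorem kernel_size_condition :
    ∃ C : ℝ, 0 < C ∧ ∀ x : ℝ, x ≠ 0 →
      IntegrableOn (fun t => ‖phiT t x‖ ^ 2 / t) (Set.Ioi (0 : ℝ)) ∧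
        Real.sqrt (∫ t in Set.Ioi (0 : ℝ), ‖phiT t x‖ ^ 2 / t) ≤ C / |x| := by
  obtain ⟨B, hB, hφB⟩ := exists_norm_phi_le
  set A : ℝ := ∫ ξ, ‖phiHat ξ‖
  have hA : 0 ≤ A := integral_nonneg fun _ => norm_nonneg _
  refine ⟨Real.sqrt (B ^ 2 + A ^ 2 + 1), by positivity, fun x hx => ?_⟩
  have hx' := abs_pos.2 hx
  have hnorm (t : ℝ) (ht : 0 < t) : ‖phiT t x‖ ^ 2 / t = ‖phi (x / t)‖ ^ 2 / t ^ 3 := by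
    rw [phiT, norm_mul, norm_inv, Complex.norm_real, Real.norm_of_nonneg ht.le]
    field_simp
  have near (t : ℝ) (ht : t ∈ Ioc 0 |x|) : ‖phiT t x‖ ^ 2 / t ≤ B ^ 2 / |x| ^ 3 := by
    have ht0 : 0 < t := ht.1
    rw [hnorm t ht0, div_le_iff₀ (by positivity)]
    have h := hφB (x / t) (by positivity)
    calc ‖phi (x / t)‖ ^ 2 ≤ (B / (|x / t| * Real.sqrt |x / t|)) ^ 2 := by gcongr
      _ = B ^ 2 / |x| ^ 3 * t ^ 3 := by
        rw [div_pow, mul_pow, Real.sq_sqrt (abs_nonneg _), abs_div, abs_of_pos ht0]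
        field_simp
  have far (t : ℝ) (ht : t ∈ Ioi |x|) : ‖phiT t x‖ ^ 2 / t ≤ A ^ 2 * t ^ (-3 : ℝ) := by
    have ht0 : 0 < t := hx'.trans ht
    rw [hnorm t ht0, Real.rpow_neg ht0.le, div_eq_mul_inv]
    norm_cast
    gcongr
    exact norm_phi_le_s4 _
  have hmeas : Measurable fun t => ‖phiT t x‖ ^ 2 / t := by
    have := continuous_phi.measurable
    unfold phiT
    fun_prop
  have i1 : IntegrableOn (fun _ : ℝ => B ^ 2 / |x| ^ 3) (Ioc 0 |x|) := by simp
  have i2 : IntegrableOn (fun t : ℝ => A ^ 2 * t ^ (-3 : ℝ)) (Ioi |x|) :=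
    (integrableOn_Ioi_rpow_of_lt (by norm_num) hx').const_mul _
  have j1 : IntegrableOn (fun t => ‖phiT t x‖ ^ 2 / t) (Ioc 0 |x|) := by
    refine Integrable.mono' i1 hmeas.aestronglyMeasurable
      ((ae_restrict_mem measurableSet_Ioc).mono fun t ht => ?_)
    rw [Real.norm_of_nonneg (div_nonneg (by positivity) ht.1.le)]
    exact near t ht
  have j2 : IntegrableOn (fun t => ‖phiT t x‖ ^ 2 / t) (Ioi |x|) := by
    refine Integrable.mono' i2 hmeas.aestronglyMeasurable
      ((ae_restrict_mem measurableSet_Ioi).mono fun t ht => ?_)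
    rw [Real.norm_of_nonneg (div_nonneg (by positivity) (hx'.trans ht).le)]
    exact far t ht
  have hunion : Ioi (0 : ℝ) = Ioc 0 |x| ∪ Ioi |x| := (Ioc_union_Ioi_eq_Ioi hx'.le).symm
  refine ⟨hunion ▸ j1.union j2, ?_⟩
  rw [hunion, setIntegral_union Ioc_disjoint_Ioi_same measurableSet_Ioi j1 j2]
  have k1 := setIntegral_mono_on j1 i1 measurableSet_Ioc near
  have k2 := setIntegral_mono_on j2 i2 measurableSet_Ioi far
  have v1 : ∫ _ in Ioc 0 |x|, B ^ 2 / |x| ^ 3 = B ^ 2 / |x| ^ 2 := by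
    rw [setIntegral_const, Measure.real, Real.volume_Ioc, sub_zero,
      ENNReal.toReal_ofReal hx'.le, smul_eq_mul]
    field_simp
  have v2 : ∫ t in Ioi |x|, A ^ 2 * t ^ (-3 : ℝ) = A ^ 2 / 2 / |x| ^ 2 := by
    rw [integral_const_mul, integral_Ioi_rpow_of_lt (by norm_num) hx',
      show (-3 : ℝ) + 1 = -2 by norm_num, Real.rpow_neg hx'.le, Real.rpow_two]
    field_simp
  rw [v1] at k1
  rw [v2] at k2
  rw [Real.sqrt_le_left (by positivity), div_pow, Real.sq_sqrt (by positivity)]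
  refine (add_le_add k1 k2).trans ?_
  rw [← add_div]
  refine div_le_div_of_nonneg_right ?_ (by positivity)
  linarith [sq_nonneg A]
end

section
/- There exists a constant C > 0 such that for all x, x' ∈ ℝ with |x| > 2|x − x'| > 0, one has (∫_0^∞ |φ_t(x) − φ_t(x')|² dt/t)^{1/2} ≤ C·|x − x'| / |x|². (This is the Lipschitz smoothness condition, with exponent α = 1, of the Calderón–Zygmund kernel k(x,y) = {φ_t(x−y)}_{t>0} with values in the Hilbert space L²((0,∞), dt/t).) -/
open MeasureTheory

section KernelEstimates

open Set Filter Topology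

/-- Rotation of the contour `(0, ∞)` to the ray through `a`, for entire functions which are
`o(1/R)` on the segments joining `R` to `a R`. -/
theorem integral_Ioi_eq_integral_ray {f : ℂ → ℂ} (hf : Differentiable ℂ f) (a : ℂ) {g : ℝ → ℝ}
    (hg : ∀ R : ℝ, 0 < R → ∀ z ∈ segment ℝ (R : ℂ) (a * R), ‖f z‖ ≤ g R)
    (hg0 : Tendsto (fun R : ℝ => g R * R) atTop (𝓝 0))
    (h1 : IntegrableOn (fun r : ℝ => f r) (Ioi 0))
    (ha : IntegrableOn (fun r : ℝ => f (a * r) * a) (Ioi 0)) :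
    ∫ r in Ioi (0 : ℝ), f r = ∫ r in Ioi (0 : ℝ), f (a * r) * a := by
  obtain ⟨P, hP⟩ := hf.isExactOn_univ
  have hray (b : ℂ) (R : ℝ) : ∫ r in (0 : ℝ)..R, f (b * r) * b = P (b * R) - P 0 := by
    rw [intervalIntegral.integral_eq_sub_of_hasDerivAt (f := fun r : ℝ => P (b * r))]
    · simp
    · intro r _
      have h2 : HasDerivAt (fun r : ℝ => b * (r : ℂ)) b r := by
        simpa using (Complex.ofRealCLM.hasDerivAt (x := r)).const_mul b
      exact (hP (b * r) (mem_univ _)).comp r h2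
    · apply Continuous.intervalIntegrable
      have := hf.continuous
      fun_prop
  have t1 := intervalIntegral_tendsto_integral_Ioi (0 : ℝ) h1 tendsto_id
  have ta := intervalIntegral_tendsto_integral_Ioi (0 : ℝ) ha tendsto_id
  have hdiff : Tendsto (fun R : ℝ => (∫ r in (0 : ℝ)..R, f r) - ∫ r in (0 : ℝ)..R, f (a * r) * a)
      atTop (𝓝 0) := by
    have h0 : Tendsto (fun R : ℝ => g R * R * ‖1 - a‖) atTop (𝓝 0) := by
      simpa using hg0.mul_const ‖1 - a‖
    refine squeeze_zero_norm' ?_ h0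
    filter_upwards [eventually_gt_atTop 0] with R hR
    have h2 := hray 1 R
    simp only [one_mul, mul_one] at h2
    rw [hray a R, h2, sub_sub_sub_cancel_right]
    have := (convex_segment (𝕜 := ℝ) (R : ℂ) (a * R)).norm_image_sub_le_of_norm_hasDerivWithin_le
      (𝕜 := ℂ) (f := P) (f' := f) (fun z _ => (hP z (mem_univ _)).hasDerivWithinAt) (hg R hR)
      (right_mem_segment ℝ _ _) (left_mem_segment ℝ _ _)
    refine this.trans (le_of_eq ?_)
    rw [show (R : ℂ) - a * R = R * (1 - a) by ring, norm_mul, Complex.norm_real,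
      Real.norm_of_nonneg hR.le, mul_assoc]
  exact sub_eq_zero.1 (tendsto_nhds_unique (t1.sub ta) hdiff)

/-- `e^{-iπ/4}`. -/
noncomputable def rootUnit : ℂ := ⟨√2 / 2, -(√2 / 2)⟩

theorem exp_neg_I_mul_pi_div_four : Complex.exp (-Complex.I * Real.pi / 4) = rootUnit := by
  rw [show -Complex.I * (Real.pi : ℂ) / 4 = ((-(Real.pi / 4) : ℝ) : ℂ) * Complex.I by
    push_cast; ring]
  apply Complex.ext
  · rw [Complex.exp_ofReal_mul_I_re, Real.cos_neg, Real.cos_pi_div_four]; rfl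
  · rw [Complex.exp_ofReal_mul_I_im, Real.sin_neg, Real.sin_pi_div_four]; rfl

theorem norm_rootUnit : ‖rootUnit‖ = 1 := by
  rw [← exp_neg_I_mul_pi_div_four, Complex.norm_exp]
  simp

/-- The integrand of `φ` on the half-line after the substitution `2πξ = r²`, up to a constant. -/
noncomputable def rootIntegrand (x : ℝ) (z : ℂ) : ℂ :=
  Complex.exp (Complex.I * x * z ^ 2) * z ^ 2 * Complex.exp (-(rootUnit * z))

theorem differentiable_rootIntegrand (x : ℝ) : Differentiable ℂ (rootIntegrand x) := by
  unfold rootIntegrand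
  fun_prop

theorem norm_exp_neg_rootUnit_mul_le {τ r : ℝ} (hτ : -(1 / 2) ≤ τ) (hr : 0 ≤ r) :
    ‖Complex.exp (-(rootUnit * ((1 + τ * Complex.I) * r)))‖ ≤ Real.exp (-(1 / 4 * r)) := by
  rw [Complex.norm_exp, Real.exp_le_exp]
  have h2 : (1 : ℝ) ≤ √2 := by rw [Real.one_le_sqrt]; norm_num
  have : (-(rootUnit * ((1 + τ * Complex.I) * r))).re = -(√2 / 2 * (1 + τ) * r) := by
    simp [rootUnit]; ring
  rw [this]
  have : 1 / 4 ≤ √2 / 2 * (1 + τ) := by nlinarith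
  nlinarith

theorem norm_one_add_mul_I_sq_le {τ : ℝ} (h1 : -(1 / 2) ≤ τ) (h2 : τ ≤ 1 / 2) :
    ‖(1 + τ * Complex.I : ℂ)‖ ^ 2 ≤ 5 / 4 := by
  rw [← Complex.normSq_eq_norm_sq, Complex.normSq_apply]
  simp
  nlinarith

theorem norm_rootIntegrand_le {x τ r : ℝ} (h1 : -(1 / 2) ≤ τ) (h2 : τ ≤ 1 / 2) (hx : 0 ≤ x * τ)
    (hr : 0 ≤ r) : ‖rootIntegrand x ((1 + τ * Complex.I) * r)‖
      ≤ 5 / 4 * (r ^ 2 * Real.exp (-(1 / 4 * r))) := by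
  have e1 : ‖Complex.exp (Complex.I * x * ((1 + τ * Complex.I) * r) ^ 2)‖ ≤ 1 := by
    rw [Complex.norm_exp, Real.exp_le_one_iff]
    have : (Complex.I * x * ((1 + τ * Complex.I) * r) ^ 2).re = -(2 * (x * τ) * r ^ 2) := by
      simp [pow_two]; ring
    rw [this]
    have : 0 ≤ 2 * (x * τ) * r ^ 2 := by positivity
    linarith
  have e2 := norm_exp_neg_rootUnit_mul_le h1 hr
  have e3 : ‖((1 + τ * Complex.I : ℂ) * r) ^ 2‖ ≤ 5 / 4 * r ^ 2 := by
    rw [norm_pow, norm_mul, mul_pow, Complex.norm_real, Real.norm_of_nonneg hr]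
    gcongr
    exact norm_one_add_mul_I_sq_le h1 h2
  unfold rootIntegrand
  rw [norm_mul, norm_mul]
  calc _ ≤ 1 * (5 / 4 * r ^ 2) * Real.exp (-(1 / 4 * r)) := by gcongr
    _ = _ := by ring

theorem integrableOn_pow_mul_exp_neg (n : ℕ) {b : ℝ} (hb : 0 < b) :
    IntegrableOn (fun r : ℝ => r ^ n * Real.exp (-(b * r))) (Ioi 0) := by
  have := integrableOn_rpow_mul_exp_neg_mul_rpow (p := 1) (s := n) (b := b)
    (by have : (0 : ℝ) ≤ n := by positivity
        linarith) one_pos hb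
  simpa [neg_mul] using this

theorem integrableOn_rootIntegrand {x τ : ℝ} (h1 : -(1 / 2) ≤ τ) (h2 : τ ≤ 1 / 2)
    (hx : 0 ≤ x * τ) :
    IntegrableOn (fun r : ℝ => rootIntegrand x ((1 + τ * Complex.I) * r)) (Ioi 0) := by
  refine Integrable.mono' ((integrableOn_pow_mul_exp_neg 2 (b := 1 / 4) (by norm_num)).const_mul
    (5 / 4)) ?_ ?_
  · have := (differentiable_rootIntegrand x).continuous
    exact Continuous.aestronglyMeasurable (by fun_prop)
  · filter_upwards [ae_restrict_mem measurableSet_Ioi] with r hr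
    exact norm_rootIntegrand_le h1 h2 hx (le_of_lt hr)

theorem integrableOn_rootIntegrand_ofReal (x : ℝ) :
    IntegrableOn (fun r : ℝ => rootIntegrand x r) (Ioi 0) := by
  simpa using integrableOn_rootIntegrand (x := x) (τ := 0) (by norm_num) (by norm_num) (by simp)

theorem integral_rootIntegrand_eq {x τ : ℝ} (h1 : -(1 / 2) ≤ τ) (h2 : τ ≤ 1 / 2)
    (hx : 0 ≤ x * τ) : ∫ r in Ioi (0 : ℝ), rootIntegrand x r =
      ∫ r in Ioi (0 : ℝ), rootIntegrand x ((1 + τ * Complex.I) * r) * (1 + τ * Complex.I) := by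
  refine integral_Ioi_eq_integral_ray (differentiable_rootIntegrand x) _
    (g := fun R => 5 / 4 * (R ^ 2 * Real.exp (-(1 / 4 * R)))) ?_ ?_
    (integrableOn_rootIntegrand_ofReal x) ((integrableOn_rootIntegrand h1 h2 hx).mul_const _)
  · rintro R hR z ⟨p, q, hp, hq, hpq, rfl⟩
    have : p • (R : ℂ) + q • ((1 + τ * Complex.I) * R) = (1 + (q * τ : ℝ) * Complex.I) * R := by
      obtain rfl : p = 1 - q := by linarith
      simp only [Complex.real_smul]
      push_cast
      ring
    rw [this]
    have hq1 : q ≤ 1 := by linarith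
    refine norm_rootIntegrand_le (by nlinarith) (by nlinarith) ?_ hR.le
    rw [mul_left_comm]
    positivity
  · have h4 : Tendsto (fun R : ℝ => 1 / 4 * R) atTop atTop :=
      tendsto_id.const_mul_atTop (by norm_num)
    have := ((Real.tendsto_pow_mul_exp_neg_atTop_nhds_zero 3).comp h4).const_mul 80
    rw [mul_zero] at this
    refine this.congr fun R => ?_
    simp only [Function.comp_apply]
    ring

theorem norm_exp_sub_exp_le {p q : ℂ} {M : ℝ} (hp : p.re ≤ M) (hq : q.re ≤ M) :
    ‖Complex.exp p - Complex.exp q‖ ≤ Real.exp M * ‖p - q‖ := by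
  refine (convex_halfSpace_re_le M).norm_image_sub_le_of_norm_hasDerivWithin_le (𝕜 := ℂ)
    (f := Complex.exp) (fun z _ => (Complex.hasDerivAt_exp z).hasDerivWithinAt) ?_ hq hp
  intro z hz
  rw [Complex.norm_exp]
  exact Real.exp_le_exp.2 hz

theorem norm_rootIntegrand_sub_le {x x' τ m r : ℝ} (h1 : -(1 / 2) ≤ τ) (h2 : τ ≤ 1 / 2)
    (hx : m ≤ 2 * (x * τ)) (hx' : m ≤ 2 * (x' * τ)) (hr : 0 ≤ r) :
    ‖rootIntegrand x ((1 + τ * Complex.I) * r) * (1 + τ * Complex.I)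
        - rootIntegrand x' ((1 + τ * Complex.I) * r) * (1 + τ * Complex.I)‖
      ≤ 4 * |x - x'| * (r ^ 4 * Real.exp (-(1 / 4 * r)) * Real.exp (-(m * r ^ 2))) := by
  have hre (y : ℝ) : (Complex.I * y * ((1 + τ * Complex.I) * r) ^ 2).re
      = -(2 * (y * τ) * r ^ 2) := by
    simp [pow_two]; ring
  have e1 := norm_exp_sub_exp_le (M := -(m * r ^ 2))
    (p := Complex.I * x * ((1 + τ * Complex.I) * r) ^ 2)
    (q := Complex.I * x' * ((1 + τ * Complex.I) * r) ^ 2)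
    (by rw [hre]; nlinarith [sq_nonneg r]) (by rw [hre]; nlinarith [sq_nonneg r])
  rw [show Complex.I * x * ((1 + τ * Complex.I) * r) ^ 2
      - Complex.I * x' * ((1 + τ * Complex.I) * r) ^ 2
      = Complex.I * (x - x' : ℝ) * ((1 + τ * Complex.I) * r) ^ 2 by push_cast; ring,
    norm_mul, norm_mul, Complex.norm_I, one_mul, Complex.norm_real, Real.norm_eq_abs,
    norm_pow, norm_mul, Complex.norm_real, Real.norm_of_nonneg hr] at e1
  have e2 := norm_exp_neg_rootUnit_mul_le h1 hr
  have e3 := norm_one_add_mul_I_sq_le h1 h2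
  have e4 : ‖(1 + τ * Complex.I : ℂ)‖ ≤ 5 / 4 := by
    nlinarith [norm_nonneg (1 + τ * Complex.I : ℂ)]
  unfold rootIntegrand
  rw [← sub_mul, ← sub_mul, ← sub_mul, norm_mul, norm_mul, norm_mul, norm_pow, norm_mul,
    Complex.norm_real, Real.norm_of_nonneg hr]
  have hA : 0 ≤ ‖(1 + τ * Complex.I : ℂ)‖ := norm_nonneg _
  generalize ‖(1 + τ * Complex.I : ℂ)‖ = A at *
  calc _ ≤ (Real.exp (-(m * r ^ 2)) * (|x - x'| * (A * r) ^ 2)) * (A * r) ^ 2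
        * Real.exp (-(1 / 4 * r)) * A := by gcongr
    _ = ((A ^ 2) * (A ^ 2) * A) *
        (|x - x'| * (r ^ 4 * Real.exp (-(1 / 4 * r)) * Real.exp (-(m * r ^ 2)))) := by ring
    _ ≤ ((5 / 4) * (5 / 4) * (5 / 4)) *
        (|x - x'| * (r ^ 4 * Real.exp (-(1 / 4 * r)) * Real.exp (-(m * r ^ 2)))) := by gcongr
    _ ≤ 4 *
        (|x - x'| * (r ^ 4 * Real.exp (-(1 / 4 * r)) * Real.exp (-(m * r ^ 2)))) := by
          gcongr; norm_num
    _ = _ := by ring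

theorem sqrtSymbol_neg (ξ : ℝ) : sqrtSymbol (-ξ) = (starRingEnd ℂ) (sqrtSymbol ξ) := by
  unfold sqrtSymbol
  rw [map_mul, ← Complex.exp_conj, abs_neg, Real.sign_neg, Complex.conj_ofReal]
  simp [Complex.conj_ofNat]

theorem phiHat_neg (ξ : ℝ) : phiHat (-ξ) = (starRingEnd ℂ) (phiHat ξ) := by
  unfold phiHat
  rw [sqrtSymbol_neg, map_mul, ← Complex.exp_conj]
  simp

theorem sqrtSymbol_sq_s5 {r : ℝ} (hr : 0 < r) :
    sqrtSymbol ((2 * Real.pi)⁻¹ * r ^ 2) = rootUnit * r := by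
  have hpi := Real.pi_pos
  have hp : 0 < (2 * Real.pi)⁻¹ * r ^ 2 := by positivity
  unfold sqrtSymbol
  rw [Real.sign_of_pos hp, abs_of_pos hp, mul_inv_cancel_left₀ (by positivity),
    Real.sqrt_sq hr.le, Complex.ofReal_one, neg_mul, one_mul, exp_neg_I_mul_pi_div_four, mul_comm]

/-- The integrand in the definition of `phi`. -/
noncomputable def phiIntegrand (x ξ : ℝ) : ℂ :=
  Complex.exp (2 * (Real.pi : ℂ) * Complex.I * (x : ℂ) * (ξ : ℂ)) * phiHat ξ

theorem phiIntegrand_neg (x ξ : ℝ) :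
    phiIntegrand x (-ξ) = (starRingEnd ℂ) (phiIntegrand x ξ) := by
  unfold phiIntegrand
  rw [phiHat_neg, map_mul, ← Complex.exp_conj]
  simp [Complex.conj_ofNat]

theorem smul_phiIntegrand_sq (x : ℝ) {r : ℝ} (hr : 0 < r) :
    (|(2 : ℝ)| * r ^ ((2 : ℝ) - 1)) • phiIntegrand x ((2 * Real.pi)⁻¹ * r ^ (2 : ℝ))
      = (-2 * rootUnit) * rootIntegrand x r := by
  have hpi : (Real.pi : ℂ) ≠ 0 := by exact_mod_cast Real.pi_ne_zero
  unfold phiIntegrand phiHat rootIntegrand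
  rw [Real.rpow_two, sqrtSymbol_sq_s5 hr, Complex.real_smul]
  have : 2 * (Real.pi : ℂ) * Complex.I * (x : ℂ) * (((2 * Real.pi)⁻¹ * r ^ 2 : ℝ) : ℂ)
      = Complex.I * x * r ^ 2 := by
    push_cast
    field_simp
  rw [this]
  norm_num
  ring

theorem integrableOn_phiIntegrand (x : ℝ) : IntegrableOn (phiIntegrand x) (Ioi 0) := by
  have hpi := Real.pi_pos
  have h := integrableOn_Ioi_comp_mul_left_iff (phiIntegrand x) 0
    (show 0 < (2 * Real.pi)⁻¹ by positivity)
  rw [mul_zero] at h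
  rw [← h, ← integrableOn_Ioi_comp_rpow_iff _ (two_ne_zero (α := ℝ))]
  refine IntegrableOn.congr_fun ((integrableOn_rootIntegrand_ofReal x).const_mul (-2 * rootUnit))
    (fun r hr => ?_) measurableSet_Ioi
  exact (smul_phiIntegrand_sq x hr).symm

theorem integral_Ioi_phiIntegrand (x : ℝ) : ∫ ξ in Ioi (0 : ℝ), phiIntegrand x ξ =
    -(Real.pi : ℂ)⁻¹ * rootUnit * ∫ r in Ioi (0 : ℝ), rootIntegrand x r := by
  have hpi := Real.pi_pos
  have h := integral_comp_mul_left_Ioi' (phiIntegrand x) 0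
    (show 0 < (2 * Real.pi)⁻¹ by positivity)
  rw [mul_zero] at h
  rw [← h, ← integral_comp_rpow_Ioi _ (two_ne_zero (α := ℝ)),
    setIntegral_congr_fun measurableSet_Ioi (fun r hr => smul_phiIntegrand_sq x hr),
    integral_const_mul, Complex.real_smul]
  push_cast
  field_simp

theorem phi_eq (x : ℝ) : phi x = (∫ ξ in Ioi (0 : ℝ), phiIntegrand x ξ)
    + (starRingEnd ℂ) (∫ ξ in Ioi (0 : ℝ), phiIntegrand x ξ) := by
  have hI : IntegrableOn (phiIntegrand x) (Iic 0) := by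
    have h2 := Complex.conjCLE.toContinuousLinearMap.integrable_comp (integrableOn_phiIntegrand x)
    have h3 : IntegrableOn (fun ξ => phiIntegrand x (-ξ)) (Ioi 0) := by
      simp only [phiIntegrand_neg]
      exact h2
    have h4 := h3.comp_neg
    simp only [neg_neg] at h4
    rw [integrableOn_Iic_iff_integrableOn_Iio]
    simpa using h4
  have h1 : phi x = ∫ ξ, phiIntegrand x ξ := rfl
  rw [h1, ← intervalIntegral.integral_Iic_add_Ioi hI (integrableOn_phiIntegrand x), add_comm,
    ← integral_conj]
  congr 1
  have := integral_comp_neg_Iic 0 (fun ξ => phiIntegrand x (-ξ))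
  simp only [neg_neg, neg_zero] at this
  rw [this]
  simp only [phiIntegrand_neg]

theorem norm_phi_sub_le (x x' : ℝ) : ‖phi x - phi x'‖ ≤
    2 * ‖(∫ r in Ioi (0 : ℝ), rootIntegrand x r) - ∫ r in Ioi (0 : ℝ), rootIntegrand x' r‖ := by
  rw [phi_eq, phi_eq, add_sub_add_comm, ← map_sub]
  refine (norm_add_le _ _).trans ?_
  rw [RCLike.norm_conj, ← two_mul, integral_Ioi_phiIntegrand, integral_Ioi_phiIntegrand, ← mul_sub,
    norm_mul, norm_mul, norm_rootUnit, norm_neg, norm_inv, Complex.norm_real,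
    Real.norm_of_nonneg Real.pi_pos.le]
  have : Real.pi⁻¹ ≤ 1 := inv_le_one_of_one_le₀ (by linarith [Real.pi_gt_three])
  gcongr
  rw [mul_one]
  exact mul_le_of_le_one_left (norm_nonneg _) this

theorem norm_phi_sub_le_integral {x x' : ℝ} (h : 2 * |x - x'| < |x|) :
    IntegrableOn (fun r : ℝ => r ^ 4 * Real.exp (-(1 / 4 * r)) *
      Real.exp (-(|x| / 2 * r ^ 2))) (Ioi 0) ∧
    ‖phi x - phi x'‖ ≤ 8 * |x - x'| * ∫ r in Ioi (0 : ℝ),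
      r ^ 4 * Real.exp (-(1 / 4 * r)) * Real.exp (-(|x| / 2 * r ^ 2)) := by
  obtain ⟨τ, h1, h2, hx, hx'⟩ : ∃ τ : ℝ, -(1 / 2) ≤ τ ∧ τ ≤ 1 / 2 ∧
      |x| / 2 ≤ 2 * (x * τ) ∧ |x| / 2 ≤ 2 * (x' * τ) := by
    have h3 := abs_le.1 (le_refl |x - x'|)
    rcases le_total 0 x with h0 | h0
    · rw [abs_of_nonneg h0] at *
      exact ⟨1 / 2, by norm_num, by norm_num, by linarith, by linarith⟩
    · rw [abs_of_nonpos h0] at *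
      exact ⟨-(1 / 2), by norm_num, by norm_num, by linarith, by linarith⟩
  have hm := abs_nonneg x
  have hI : IntegrableOn (fun r : ℝ => r ^ 4 * Real.exp (-(1 / 4 * r)) *
      Real.exp (-(|x| / 2 * r ^ 2))) (Ioi 0) := by
    refine Integrable.mono' (integrableOn_pow_mul_exp_neg 4 (b := 1 / 4) (by norm_num)) ?_ ?_
    · exact Continuous.aestronglyMeasurable (by fun_prop)
    · refine Eventually.of_forall fun r => ?_
      rw [Real.norm_of_nonneg (by positivity)]
      refine mul_le_of_le_one_right (by positivity) ?_
      rw [Real.exp_le_one_iff]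
      have : 0 ≤ |x| / 2 * r ^ 2 := by positivity
      linarith
  refine ⟨hI, (norm_phi_sub_le x x').trans ?_⟩
  rw [integral_rootIntegrand_eq h1 h2 (by linarith), integral_rootIntegrand_eq h1 h2 (by linarith),
    ← integral_sub ((integrableOn_rootIntegrand h1 h2 (by linarith)).mul_const _)
      ((integrableOn_rootIntegrand h1 h2 (by linarith)).mul_const _)]
  have := norm_integral_le_of_norm_le (hI.integrable.const_mul (4 * |x - x'|))
    ((ae_restrict_mem measurableSet_Ioi).mono fun r (hr : 0 < r) =>
      norm_rootIntegrand_sub_le h1 h2 hx hx' hr.le)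
  rw [integral_const_mul] at this
  linarith

theorem exists_norm_phi_sub_le : ∃ K : ℝ, 0 < K ∧ ∀ x x' : ℝ, 2 * |x - x'| < |x| →
    ‖phi x - phi x'‖ ^ 2 ≤ K * |x - x'| ^ 2 ∧
    ‖phi x - phi x'‖ ^ 2 ≤ K * |x - x'| ^ 2 / |x| ^ 5 := by
  set K₁ := ∫ r in Ioi (0 : ℝ), r ^ 4 * Real.exp (-(1 / 4 * r))
  set K₂ : ℝ := (1 / 2 : ℝ) ^ (-(5 / 2) : ℝ) * (1 / 2) * Real.Gamma (5 / 2) with hK₂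
  have hK₂' : ∀ m : ℝ, 0 < m → ∫ r in Ioi (0 : ℝ), r ^ 4 * Real.exp (-(m / 2 * r ^ 2))
      = K₂ * m ^ (-(5 / 2) : ℝ) := by
    intro m hm
    have := integral_rpow_mul_exp_neg_mul_rpow (p := 2) (q := 4) (b := m / 2) (by norm_num)
      (by norm_num) (by positivity)
    norm_num [Real.rpow_ofNat] at this
    rw [this, hK₂, div_eq_mul_one_div m 2, Real.mul_rpow hm.le (by norm_num)]
    ring
  have hK₂0 : 0 ≤ K₂ := by
    have := Real.Gamma_pos_of_pos (show (0 : ℝ) < 5 / 2 by norm_num)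
    positivity
  have hK₁0 : 0 ≤ K₁ := setIntegral_nonneg measurableSet_Ioi fun r _ => by positivity
  refine ⟨(8 * (K₁ + K₂ + 1)) ^ 2, by positivity, fun x x' h => ?_⟩
  have hm : 0 < |x| := by linarith [abs_nonneg (x - x')]
  obtain ⟨hI, hle⟩ := norm_phi_sub_le_integral h
  constructor
  · rw [← mul_pow]
    gcongr
    refine hle.trans ?_
    have : (∫ r in Ioi (0 : ℝ), r ^ 4 * Real.exp (-(1 / 4 * r)) * Real.exp (-(|x| / 2 * r ^ 2)))
        ≤ K₁ := by
      refine setIntegral_mono_on hI (integrableOn_pow_mul_exp_neg 4 (by norm_num))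
        measurableSet_Ioi fun r _ => ?_
      refine mul_le_of_le_one_right (by positivity) ?_
      rw [Real.exp_le_one_iff]
      have : 0 ≤ |x| / 2 * r ^ 2 := by positivity
      linarith
    have h3 : (∫ r in Ioi (0 : ℝ), r ^ 4 * Real.exp (-(1 / 4 * r)) *
      Real.exp (-(|x| / 2 * r ^ 2))) ≤ K₁ + K₂ + 1 := by linarith
    calc _ ≤ 8 * |x - x'| * (K₁ + K₂ + 1) := by gcongr
      _ = _ := by ring
  · have : (∫ r in Ioi (0 : ℝ), r ^ 4 * Real.exp (-(1 / 4 * r)) * Real.exp (-(|x| / 2 * r ^ 2)))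
        ≤ K₂ * |x| ^ (-(5 / 2) : ℝ) := by
      rw [← hK₂' _ hm]
      have hg := integrableOn_rpow_mul_exp_neg_mul_sq (b := |x| / 2) (s := 4) (by positivity)
        (by norm_num)
      simp only [Real.rpow_ofNat, neg_mul] at hg
      refine setIntegral_mono_on hI hg measurableSet_Ioi fun r (hr : 0 < r) => ?_
      gcongr
      refine mul_le_of_le_one_right (by positivity) ?_
      rw [Real.exp_le_one_iff]
      linarith
    have h5 : (|x| ^ (-(5 / 2) : ℝ)) ^ 2 = (|x| ^ 5)⁻¹ := by
      rw [← Real.rpow_natCast, ← Real.rpow_mul hm.le, ← Real.rpow_natCast, ← Real.rpow_neg hm.le]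
      norm_num
    rw [div_eq_mul_inv, ← h5, ← mul_pow, ← mul_pow]
    gcongr
    refine hle.trans ?_
    calc _ ≤ 8 * |x - x'| * (K₂ * |x| ^ (-(5 / 2) : ℝ)) := by gcongr
      _ ≤ 8 * |x - x'| * ((K₁ + K₂ + 1) * |x| ^ (-(5 / 2) : ℝ)) := by gcongr; linarith
      _ = _ := by ring

theorem norm_phiT_sub_sq_div_le {K : ℝ}
    (hK : ∀ x x' : ℝ, 2 * |x - x'| < |x| → ‖phi x - phi x'‖ ^ 2 ≤ K * |x - x'| ^ 2 ∧
      ‖phi x - phi x'‖ ^ 2 ≤ K * |x - x'| ^ 2 / |x| ^ 5)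
    {x x' t : ℝ} (h : 2 * |x - x'| < |x|) (ht : 0 < t) :
    ‖phiT t x - phiT t x'‖ ^ 2 / t ≤ K * |x - x'| ^ 2 * (t ^ 5)⁻¹ ∧
    ‖phiT t x - phiT t x'‖ ^ 2 / t ≤ K * |x - x'| ^ 2 * (|x| ^ 5)⁻¹ := by
  have hm : 0 < |x| := by linarith [abs_nonneg (x - x')]
  have hd : |x / t - x' / t| = |x - x'| / t := by rw [← sub_div, abs_div, abs_of_pos ht]
  have hx : |x / t| = |x| / t := by rw [abs_div, abs_of_pos ht]
  have hn : ‖phiT t x - phiT t x'‖ ^ 2 / t = ‖phi (x / t) - phi (x' / t)‖ ^ 2 / t ^ 3 := by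
    unfold phiT
    rw [← mul_sub, norm_mul, norm_inv, Complex.norm_real, Real.norm_of_nonneg ht.le]
    field_simp
  obtain ⟨h1, h2⟩ := hK (x / t) (x' / t) (by
    rw [hd, hx, ← mul_div_assoc]; gcongr)
  rw [hd] at h1
  rw [hd, hx] at h2
  rw [hn]
  constructor
  · calc _ ≤ K * (|x - x'| / t) ^ 2 / t ^ 3 := by gcongr
      _ = _ := by field_simp
  · calc _ ≤ K * (|x - x'| / t) ^ 2 / (|x| / t) ^ 5 / t ^ 3 := by gcongr
      _ = _ := by field_simp

theorem integral_Ioi_le_of_le_min {F : ℝ → ℝ} {A m : ℝ} (hm : 0 < m) (hF0 : ∀ t, 0 < t → 0 ≤ F t)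
    (hF1 : ∀ t, 0 < t → F t ≤ A * (t ^ 5)⁻¹) (hF2 : ∀ t, 0 < t → F t ≤ A * (m ^ 5)⁻¹) :
    ∫ t in Ioi (0 : ℝ), F t ≤ A * (5 / 4) * (m ^ 4)⁻¹ := by
  let g : ℝ → ℝ := fun t => if t ≤ m then A * (m ^ 5)⁻¹ else A * (t ^ 5)⁻¹
  have hpow : ∀ t ∈ Ioi m, A * t ^ (-5 : ℝ) = A * (t ^ 5)⁻¹ := fun t ht => by
    rw [Real.rpow_neg (hm.trans ht).le]; norm_num
  have e1 : EqOn (fun _ => A * (m ^ 5)⁻¹) g (Ioc 0 m) := fun t ht => (if_pos ht.2).symm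
  have e2 : EqOn (fun t => A * t ^ (-5 : ℝ)) g (Ioi m) := fun t ht =>
    (hpow t ht).trans (if_neg (not_le.2 ht)).symm
  have i1 : IntegrableOn g (Ioc 0 m) :=
    IntegrableOn.congr_fun (integrableOn_const (by simp)) e1 measurableSet_Ioc
  have i2 : IntegrableOn g (Ioi m) := IntegrableOn.congr_fun
    ((integrableOn_Ioi_rpow_of_lt (by norm_num) hm).const_mul A) e2 measurableSet_Ioi
  have hu := Ioc_union_Ioi_eq_Ioi hm.le
  have hle : ∫ t in Ioi (0 : ℝ), F t ≤ ∫ t in Ioi (0 : ℝ), g t := by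
    refine integral_mono_of_nonneg ?_ (hu ▸ i1.union i2) ?_
    · exact (ae_restrict_mem measurableSet_Ioi).mono fun t ht => hF0 t ht
    · refine (ae_restrict_mem measurableSet_Ioi).mono fun t ht => ?_
      simp only [g]
      split_ifs
      exacts [hF2 t ht, hF1 t ht]
  refine hle.trans (le_of_eq ?_)
  rw [← hu, setIntegral_union (Ioc_disjoint_Ioi le_rfl) measurableSet_Ioi i1 i2,
    ← setIntegral_congr_fun measurableSet_Ioc e1, ← setIntegral_congr_fun measurableSet_Ioi e2,
    setIntegral_const, integral_const_mul, integral_Ioi_rpow_of_lt (by norm_num) hm]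
  have : m ^ ((-5 : ℝ) + 1) = (m ^ 4)⁻¹ := by
    rw [show (-5 : ℝ) + 1 = -(4 : ℝ) by norm_num, Real.rpow_neg hm.le]; norm_num
  rw [this]
  simp [hm.le]
  field_simp
  norm_num

end KernelEstimates

/-- Lipschitz smoothness condition (exponent `α = 1`) of the kernel
`k(x,y) = {φ_t(x−y)}_{t>0}` with values in `L²((0,∞), dt/t)`:
for `|x| > 2|x−x'| > 0`,
`(∫_0^∞ |φ_t(x) − φ_t(x')|² dt/t)^{1/2} ≤ C·|x−x'|/|x|²`. -/
theorem kernel_smoothness_condition :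
    ∃ C : ℝ, 0 < C ∧ ∀ x x' : ℝ, 2 * |x - x'| < |x| → 0 < 2 * |x - x'| →
      Real.sqrt (∫ t in Set.Ioi (0 : ℝ), ‖phiT t x - phiT t x'‖ ^ 2 / t)
        ≤ C * |x - x'| / |x| ^ 2 := by
  obtain ⟨K, hK0, hK⟩ := exists_norm_phi_sub_le
  refine ⟨√(K * (5 / 4)), by positivity, fun x x' h _ => ?_⟩
  have hm : 0 < |x| := by linarith [abs_nonneg (x - x')]
  rw [Real.sqrt_le_left (by positivity)]
  refine (integral_Ioi_le_of_le_min hm (A := K * |x - x'| ^ 2) (fun t ht => by positivity)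
    (fun t ht => (norm_phiT_sub_sq_div_le hK h ht).1)
    (fun t ht => (norm_phiT_sub_sq_div_le hK h ht).2)).trans (le_of_eq ?_)
  rw [div_pow, mul_pow, Real.sq_sqrt (by positivity)]
  ring
end
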